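/- arXiv:1908.06333 — 3 statements merged into one kernel-verified Lean document; each statement's English description precedes it below -/
import Mathlib

section
/- Let r = r(n) ≥ 3 and let p = p(n) ∈ [0,1] with m_0 = Np satisfying r^{-2} n ≤ m_0 = o(r^{-3} n^{3/2}) as n → ∞. Let M_n denote a random variable distributed as the number of edges of H_r(n,p) conditioned on the event that H_r(n,p) is linear. Then the normalized random variables ( M_n − ( m_0 − [r]_2^2 m_0^2 / (2n^2) ) ) / √m_0 converge in distribution, as n → ∞, to the standard normal distribution. -/
open Filter Finset MeasureTheory ProbabilityTheory

/-- A hypergraph is linear if any two distinct edges share at most one vertex. -/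
def IsLinear {n : ℕ} (H : Finset (Finset (Fin n))) : Prop :=
  ∀ e ∈ H, ∀ f ∈ H, e ≠ f → (e ∩ f).card ≤ 1

instance {n : ℕ} : DecidablePred (IsLinear (n := n)) := fun _ => by
  unfold IsLinear; infer_instance

/-- The probability that the binomial random `r`-graph `H_r(n,p)`, in which each `r`-subset of
`Fin n` is an edge independently with probability `p`, is linear. -/
noncomputable def probLinear (n r : ℕ) (p : ℝ) : ℝ :=
  ∑ H ∈ Finset.univ.filter (fun H : Finset (Finset (Fin n)) =>
      (∀ e ∈ H, e.card = r) ∧ IsLinear H),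
    p ^ H.card * (1 - p) ^ (n.choose r - H.card)

/-- The law on `ℝ` of `(M - a)/b`, where `M` is the number of edges of `H_r(n,p)` conditioned
on `H_r(n,p)` being linear. -/
noncomputable def condEdgeLaw (n r : ℕ) (p a b : ℝ) : Measure ℝ :=
  (ENNReal.ofReal (probLinear n r p))⁻¹ •
    ∑ H ∈ Finset.univ.filter (fun H : Finset (Finset (Fin n)) =>
        (∀ e ∈ H, e.card = r) ∧ IsLinear H),
      ENNReal.ofReal (p ^ H.card * (1 - p) ^ (n.choose r - H.card)) •
        Measure.dirac (((H.card : ℝ) - a) / b)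

/-- The expected number of edges `m₀ = N p` of `H_r(n,p)`. -/
noncomputable def expEdges (r : ℕ → ℕ) (p : ℕ → ℝ) (n : ℕ) : ℝ :=
  (n.choose (r n) : ℝ) * p n

section HardCore

variable {α : Type*} [DecidableEq α] (V : Finset α) (C : α → α → Prop) [DecidableRel C]

/-- The subsets of `V` no two distinct elements of which are related by `C`. -/
def indepSets : Finset (Finset α) :=
  V.powerset.filter fun H => ∀ e ∈ H, ∀ f ∈ H, e ≠ f → ¬ C e f

/-- The elements of `V` related by `C` to no element of `H`. -/
def freeElems (H : Finset α) : Finset α := V.filter fun e => ∀ f ∈ H, ¬ C e f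

variable {V C}

lemma subset_of_mem_indepSets {H : Finset α} (hH : H ∈ indepSets V C) : H ⊆ V :=
  mem_powerset.1 (mem_filter.1 hH).1

lemma sum_indepSets_erase {M : Type*} [AddCommMonoid M] (hrefl : ∀ e ∈ V, C e e)
    (hsymm : ∀ e f, C e f → C f e) (F : α → Finset α → M) :
    ∑ H ∈ indepSets V C, ∑ e ∈ H, F e (H.erase e) =
      ∑ H ∈ indepSets V C, ∑ e ∈ freeElems V C H, F e H := by
  have hnot : ∀ H, ∀ e ∈ freeElems V C H, e ∉ H := fun H e he heH => by
    simp only [freeElems, mem_filter] at he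
    exact he.2 e heH (hrefl e he.1)
  rw [Finset.sum_sigma', Finset.sum_sigma']
  refine Finset.sum_bij' (fun x _ => ⟨x.1.erase x.2, x.2⟩) (fun x _ => ⟨insert x.2 x.1, x.2⟩)
    ?_ ?_ ?_ ?_ ?_
  · rintro ⟨H, e⟩ h
    simp only [indepSets, freeElems, mem_sigma, mem_filter, mem_powerset] at h ⊢
    obtain ⟨⟨hV, hI⟩, he⟩ := h
    refine ⟨⟨(erase_subset _ _).trans hV, fun a ha b hb => ?_⟩, hV he, fun f hf => ?_⟩
    · exact hI a (mem_of_mem_erase ha) b (mem_of_mem_erase hb)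
    · exact hI e he f (mem_of_mem_erase hf) (ne_of_mem_erase hf).symm
  · rintro ⟨H, e⟩ h
    simp only [indepSets, freeElems, mem_sigma, mem_filter, mem_powerset] at h ⊢
    obtain ⟨⟨hV, hI⟩, he, hC⟩ := h
    refine ⟨⟨insert_subset he hV, ?_⟩, mem_insert_self _ _⟩
    intro a ha b hb hab
    rcases mem_insert.1 ha with rfl | ha' <;> rcases mem_insert.1 hb with rfl | hb'
    · exact absurd rfl hab
    · exact hC b hb'
    · exact fun h => hC a ha' (hsymm _ _ h)
    · exact hI a ha' b hb' hab
  · rintro ⟨H, e⟩ h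
    simp only [mem_sigma] at h
    simp [insert_erase h.2]
  · rintro ⟨H, e⟩ h
    simp only [mem_sigma] at h
    simp [erase_insert (hnot H e h.2)]
  · rintro ⟨H, e⟩ h
    rfl

lemma sum_indepSets_erase_le (hrefl : ∀ e ∈ V, C e e) (hsymm : ∀ e f, C e f → C f e) {l : ℝ}
    (hl : 0 ≤ l) (d : α → Finset α → ℝ) (hd : ∀ e H, 0 ≤ d e H) :
    ∑ H ∈ indepSets V C, l ^ H.card * ∑ e ∈ H, d e (H.erase e) ≤
      l * ∑ H ∈ indepSets V C, l ^ H.card * ∑ e ∈ V, d e H := by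
  have h := sum_indepSets_erase hrefl hsymm (fun e H => l ^ (H.card + 1) * d e H)
  have h1 : ∑ H ∈ indepSets V C, l ^ H.card * ∑ e ∈ H, d e (H.erase e) =
      ∑ H ∈ indepSets V C, ∑ e ∈ H, l ^ ((H.erase e).card + 1) * d e (H.erase e) := by
    refine sum_congr rfl fun H _ => ?_
    rw [mul_sum]
    exact sum_congr rfl fun e he => by rw [card_erase_add_one he]
  rw [h1, h, mul_sum]
  refine sum_le_sum fun H _ => ?_
  rw [← mul_sum, pow_succ', mul_assoc]
  gcongr
  · exact fun _ _ _ => hd _ _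
  · exact filter_subset _ _

lemma sum_card_mul_eq (hrefl : ∀ e ∈ V, C e e) (hsymm : ∀ e f, C e f → C f e) (l : ℝ)
    (g : ℕ → ℂ) :
    ∑ H ∈ indepSets V C, (l : ℂ) ^ H.card * (H.card * g H.card) =
      ∑ H ∈ indepSets V C, (l : ℂ) ^ H.card * (l * (freeElems V C H).card * g (H.card + 1)) := by
  have h := sum_indepSets_erase hrefl hsymm
    (fun _ H => (l : ℂ) ^ (H.card + 1) * g (H.card + 1))
  have h1 : ∑ H ∈ indepSets V C, (l : ℂ) ^ H.card * (H.card * g H.card) =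
      ∑ H ∈ indepSets V C, ∑ e ∈ H,
        (l : ℂ) ^ ((H.erase e).card + 1) * g ((H.erase e).card + 1) := by
    refine sum_congr rfl fun H _ => ?_
    rw [sum_congr rfl fun e he => by rw [card_erase_add_one he], sum_const, nsmul_eq_mul]
    ring
  rw [h1, h]
  refine sum_congr rfl fun H _ => ?_
  rw [sum_const, nsmul_eq_mul]
  ring

lemma card_sub_sum_le_card_freeElems (H : Finset α) :
    (V.card : ℝ) - ∑ f ∈ H, ((V.filter fun e => C e f).card : ℝ) ≤ (freeElems V C H).card := by
  have h1 : V ⊆ freeElems V C H ∪ H.biUnion fun f => V.filter fun e => C e f := by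
    intro e he
    by_cases h : ∀ f ∈ H, ¬ C e f
    · exact mem_union_left _ (mem_filter.2 ⟨he, h⟩)
    · push Not at h
      obtain ⟨f, hf, hC⟩ := h
      exact mem_union_right _ (mem_biUnion.2 ⟨f, hf, mem_filter.2 ⟨he, hC⟩⟩)
  have h2 := (card_le_card h1).trans ((card_union_le _ _).trans
    (add_le_add_right card_biUnion_le _))
  have h3 : (V.card : ℝ) ≤ (freeElems V C H).card +
      ∑ f ∈ H, ((V.filter fun e => C e f).card : ℝ) := by exact_mod_cast h2
  linarith

lemma card_freeElems_le (H : Finset α) :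
    ((freeElems V C H).card : ℝ) ≤ V.card - ∑ f ∈ H, ((V.filter fun e => C e f).card : ℝ) +
      ∑ f ∈ H, ∑ f' ∈ H.erase f, ((V.filter fun e => C e f ∧ C e f').card : ℝ) := by
  have e1 : ((freeElems V C H).card : ℝ) = ∑ e ∈ V, if (∀ f ∈ H, ¬ C e f) then (1 : ℝ) else 0 := by
    simp [freeElems]
  have e2 : ∑ f ∈ H, ((V.filter fun e => C e f).card : ℝ) =
      ∑ e ∈ V, ((H.filter fun f => C e f).card : ℝ) := by
    simp only [card_filter, Nat.cast_sum, Nat.cast_ite, Nat.cast_one, Nat.cast_zero]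
    rw [sum_comm]
  have e3 : ∑ f ∈ H, ∑ f' ∈ H.erase f, ((V.filter fun e => C e f ∧ C e f').card : ℝ) =
      ∑ e ∈ V, ((H.filter fun f => C e f).card : ℝ) * ((H.filter fun f => C e f).card - 1) := by
    have : ∀ f ∈ H, ∑ f' ∈ H.erase f, ((V.filter fun e => C e f ∧ C e f').card : ℝ) =
        ∑ e ∈ V, if C e f then (((H.filter fun f => C e f).card : ℝ) - 1) else 0 := by
      intro f hf
      simp only [card_filter, Nat.cast_sum, Nat.cast_ite, Nat.cast_one, Nat.cast_zero]
      rw [sum_comm]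
      refine sum_congr rfl fun e _ => ?_
      by_cases hC : C e f
      · simp only [hC, true_and, if_true]
        rw [← add_sum_erase H _ hf]
        simp [hC]
      · simp [hC]
    rw [sum_congr rfl this, sum_comm]
    refine sum_congr rfl fun e _ => ?_
    rw [← sum_filter, sum_const, nsmul_eq_mul]
  have e4 : (V.card : ℝ) = ∑ e ∈ V, (1 : ℝ) := by simp
  rw [e1, e2, e3, e4, ← sum_sub_distrib, ← sum_add_distrib]
  refine sum_le_sum fun e _ => ?_
  split_ifs with h
  · rw [filter_eq_empty_iff.2 h]
    simp
  · nlinarith [sq_nonneg (((H.filter fun f => C e f).card : ℝ) - 1)]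

lemma sum_pairs_le (hrefl : ∀ e ∈ V, C e e) (hsymm : ∀ e f, C e f → C f e) {l T : ℝ}
    (hl : 0 ≤ l) (hT : ∀ f ∈ V, ((V.filter fun e => C e f).card : ℝ) ≤ T) :
    ∑ H ∈ indepSets V C, l ^ H.card * ∑ f ∈ H, ∑ f' ∈ H.erase f,
        ((V.filter fun e => C e f ∧ C e f').card : ℝ) ≤
      l ^ 2 * V.card * T ^ 2 * ∑ H ∈ indepSets V C, l ^ H.card := by
  have h1 := sum_indepSets_erase_le hrefl hsymm hl
    (fun f H => ∑ f' ∈ H, ((V.filter fun e => C e f ∧ C e f').card : ℝ))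
    (fun f H => sum_nonneg fun _ _ => Nat.cast_nonneg _)
  have h2 := sum_indepSets_erase_le hrefl hsymm hl
    (fun f' _ => ∑ f ∈ V, ((V.filter fun e => C e f ∧ C e f').card : ℝ))
    (fun f H => sum_nonneg fun _ _ => Nat.cast_nonneg _)
  have h3 : ∑ f' ∈ V, ∑ f ∈ V, ((V.filter fun e => C e f ∧ C e f').card : ℝ) ≤
      V.card * T ^ 2 := by
    have : ∑ f' ∈ V, ∑ f ∈ V, ((V.filter fun e => C e f ∧ C e f').card : ℝ) =
        ∑ e ∈ V, ((V.filter fun f => C e f).card : ℝ) ^ 2 := by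
      simp only [card_filter, Nat.cast_sum, Nat.cast_ite, Nat.cast_one, Nat.cast_zero, sq,
        sum_mul_sum]
      rw [sum_congr rfl fun _ _ => sum_comm, sum_comm]
      refine sum_congr rfl fun e _ => sum_congr rfl fun f _ => sum_congr rfl fun f' _ => ?_
      by_cases h : C e f <;> by_cases h' : C e f' <;> simp [h, h']
    rw [this, ← nsmul_eq_mul]
    refine sum_le_card_nsmul _ _ _ fun e he => ?_
    have h := hT e he
    rw [filter_congr fun f _ => ⟨fun h => hsymm f e h, fun h => hsymm e f h⟩] at h
    gcongr
  refine h1.trans ?_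
  have h4 : ∀ H : Finset α, ∑ e ∈ V, ∑ f' ∈ H, ((V.filter fun x => C x e ∧ C x f').card : ℝ) =
      ∑ f' ∈ H, ∑ e ∈ V, ((V.filter fun x => C x e ∧ C x f').card : ℝ) := fun H => sum_comm
  simp only [h4]
  refine (mul_le_mul_of_nonneg_left h2 hl).trans ?_
  rw [← sum_mul]
  have hZ : 0 ≤ ∑ H ∈ indepSets V C, l ^ H.card := sum_nonneg fun _ _ => pow_nonneg hl _
  calc _ ≤ l * (l * ((∑ H ∈ indepSets V C, l ^ H.card) * (V.card * T ^ 2))) := by gcongr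
    _ = _ := by ring

/-- Approximate Stein identity for the number of elements in the hard-core model with
activity `l`, when every element has between `T - D` and `T` conflicts. -/
lemma norm_sum_stein_le (hrefl : ∀ e ∈ V, C e e) (hsymm : ∀ e f, C e f → C f e) {l T D : ℝ}
    (hl : 0 ≤ l) (hT : ∀ f ∈ V, ((V.filter fun e => C e f).card : ℝ) ≤ T)
    (hD0 : 0 ≤ D) (hD : ∀ f ∈ V, T - D ≤ ((V.filter fun e => C e f).card : ℝ)) (g : ℕ → ℂ)
    (hg : ∀ k, ‖g k‖ ≤ 1) :
    ‖∑ H ∈ indepSets V C, (l : ℂ) ^ H.card *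
        (H.card * g H.card - l * (V.card - T * H.card) * g (H.card + 1))‖ ≤
      l * (l * V.card * D + l ^ 2 * V.card * T ^ 2) * ∑ H ∈ indepSets V C, l ^ H.card := by
  set P : Finset α → ℝ := fun H => ∑ f ∈ H, ∑ f' ∈ H.erase f,
    ((V.filter fun e => C e f ∧ C e f').card : ℝ) with hP
  have hlow : ∀ H ∈ indepSets V C, (V.card : ℝ) - T * H.card ≤ (freeElems V C H).card := by
    intro H hH
    have h1 := card_sub_sum_le_card_freeElems (V := V) (C := C) H
    have h2 := sum_le_card_nsmul H (fun f => ((V.filter fun e => C e f).card : ℝ)) T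
      fun f hf => hT f (subset_of_mem_indepSets hH hf)
    rw [nsmul_eq_mul] at h2
    linarith
  have hup : ∀ H ∈ indepSets V C, ((freeElems V C H).card : ℝ) ≤
      V.card - T * H.card + D * H.card + P H := by
    intro H hH
    have h1 := card_freeElems_le (V := V) (C := C) H
    have h2 := card_nsmul_le_sum H (fun f => ((V.filter fun e => C e f).card : ℝ)) (T - D)
      fun f hf => hD f (subset_of_mem_indepSets hH hf)
    rw [nsmul_eq_mul] at h2
    simp only [hP]
    linarith
  have hmean : ∑ H ∈ indepSets V C, l ^ H.card * H.card ≤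
      l * V.card * ∑ H ∈ indepSets V C, l ^ H.card := by
    have h := sum_indepSets_erase_le hrefl hsymm hl (fun _ _ => 1) fun _ _ => zero_le_one
    simp only [sum_const, nsmul_eq_mul, mul_one, ← sum_mul] at h
    linarith
  have hpair := sum_pairs_le hrefl hsymm hl hT
  simp only [mul_sub, sum_sub_distrib]
  rw [sum_card_mul_eq hrefl hsymm, ← sum_sub_distrib]
  calc _ ≤ ∑ H ∈ indepSets V C, l ^ H.card * (l * (D * H.card + P H)) := by
        refine norm_sum_le_of_le _ fun H hH => ?_
        have e : (l : ℂ) ^ H.card * (l * (freeElems V C H).card * g (H.card + 1)) -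
            (l : ℂ) ^ H.card * ((l * V.card - l * (T * H.card)) * g (H.card + 1)) =
            ((l ^ H.card * (l * ((freeElems V C H).card - (V.card - T * H.card))) : ℝ) : ℂ) *
              g (H.card + 1) := by
          push_cast
          ring
        have h1 := hlow H hH
        have h2 := hup H hH
        rw [e, norm_mul, Complex.norm_of_nonneg
          (mul_nonneg (pow_nonneg hl _) (mul_nonneg hl (by linarith)))]
        calc _ ≤ l ^ H.card * (l * ((freeElems V C H).card - (V.card - T * H.card))) * 1 :=
              mul_le_mul_of_nonneg_left (hg _)
                (mul_nonneg (pow_nonneg hl _) (mul_nonneg hl (by linarith)))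
          _ ≤ _ := by
              rw [mul_one]
              gcongr
              linarith
    _ = l * (D * ∑ H ∈ indepSets V C, l ^ H.card * H.card +
          ∑ H ∈ indepSets V C, l ^ H.card * P H) := by
        simp only [mul_sum, ← sum_add_distrib]
        exact sum_congr rfl fun H _ => by ring
    _ ≤ l * (D * (l * V.card * ∑ H ∈ indepSets V C, l ^ H.card) +
          l ^ 2 * V.card * T ^ 2 * ∑ H ∈ indepSets V C, l ^ H.card) := by gcongr
    _ = _ := by ring

end HardCore

section SubsetCounting

lemma two_mul_choose_three_add_indicator (k : ℕ) :
    k.choose 2 ≤ (if 2 ≤ k then 1 else 0) + 2 * k.choose 3 := by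
  match k with
  | 0 | 1 | 2 | 3 => decide
  | k + 4 =>
    have h : (k + 4).choose 3 * 3 = (k + 4).choose 2 * (k + 2) := Nat.choose_succ_right_eq (k + 4) 2
    rw [if_pos (by omega)]
    nlinarith [Nat.zero_le ((k + 4).choose 2 * k)]

lemma sum_choose_card_inter {n r : ℕ} (k : ℕ) {f : Finset (Fin n)} (hf : f.card = r)
    (hkr : k ≤ r) :
    ∑ e ∈ powersetCard r (univ : Finset (Fin n)), ((e ∩ f).card).choose k =
      r.choose k * (n - k).choose (r - k) := by
  have h1 : ∀ e : Finset (Fin n), ((e ∩ f).card).choose k =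
      ((powersetCard k f).filter fun P => P ⊆ e).card := fun e => by
    rw [← card_powersetCard]
    congr 1
    ext P
    simp only [mem_powersetCard, mem_filter, subset_inter_iff]
    tauto
  simp only [h1, card_filter]
  rw [sum_comm]
  have h2 : ∀ P ∈ powersetCard k f,
      (∑ e ∈ powersetCard r (univ : Finset (Fin n)), if P ⊆ e then 1 else 0) =
        (n - k).choose (r - k) := fun P hP => by
    have hc := (mem_powersetCard.1 hP).2
    rw [← card_filter, card_filter_powersetCard_subset P univ r (subset_univ P) (by rw [hc]; exact hkr), hc]
    simp
  rw [sum_congr rfl h2, sum_const, card_powersetCard, hf, smul_eq_mul]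

lemma card_filter_le_choose {n r : ℕ} (hr : 3 ≤ r) {f : Finset (Fin n)} (hf : f.card = r) :
    ((powersetCard r (univ : Finset (Fin n))).filter fun e => 2 ≤ (e ∩ f).card).card ≤
      r.choose 2 * (n - 2).choose (r - 2) := by
  rw [← sum_choose_card_inter 2 hf (by omega), card_filter]
  refine sum_le_sum fun e _ => ?_
  split_ifs with h
  · exact Nat.choose_pos h
  · exact Nat.zero_le _

lemma choose_le_card_filter {n r : ℕ} (hr : 3 ≤ r) {f : Finset (Fin n)} (hf : f.card = r) :
    r.choose 2 * (n - 2).choose (r - 2) ≤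
    ((powersetCard r (univ : Finset (Fin n))).filter fun e => 2 ≤ (e ∩ f).card).card +
      2 * (r.choose 3 * (n - 3).choose (r - 3)) := by
  rw [← sum_choose_card_inter 2 hf (by omega), ← sum_choose_card_inter 3 hf hr, card_filter,
    mul_sum, ← sum_add_distrib]
  exact sum_le_sum fun e _ => two_mul_choose_three_add_indicator _

lemma choose_mul_choose_sub_eq {n r k : ℕ} (hkr : k ≤ r) (hrn : r ≤ n) :
    (r.choose k * (n - k).choose (r - k) : ℝ) =
      (r.choose k : ℝ) ^ 2 / n.choose k * n.choose r := by
  have h : (n.choose r * r.choose k : ℝ) = n.choose k * (n - k).choose (r - k) := by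
    exact_mod_cast Nat.choose_mul (n := n) (k := r) (s := k) hkr
  have h0 : (n.choose k : ℝ) ≠ 0 := by exact_mod_cast (Nat.choose_pos (hkr.trans hrn)).ne'
  field_simp
  linear_combination -(r.choose k : ℝ) * h

end SubsetCounting

section CharacteristicFunction

open Complex in
lemma norm_drift_sub_le {s m c c' u : ℝ} (hs : 0 < s) (hus : |u| ≤ s) (hm : 0 ≤ m) (hc : 0 ≤ c)
    (hc' : 0 ≤ c') :
    ‖(m : ℂ) * cexp (u / s * I) -
        (1 + c * m * cexp (u / s * I)) * ((s ^ 2 - c' * s ^ 4) + u * s * I)‖ ≤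
      |m - s ^ 2| + u ^ 2 + |c' - c| * s ^ 4 + c * s ^ 2 * |m - s ^ 2| + c * s ^ 3 * |u| +
        c * c' * m * s ^ 4 + |u| * s * c * m := by
  set z : ℂ := cexp (u / s * I) with hz
  have hs' : (s : ℂ) ≠ 0 := by exact_mod_cast hs.ne'
  have hz1 : ‖z‖ = 1 := by
    rw [hz, ← ofReal_div]
    exact norm_exp_ofReal_mul_I _
  have hnorm : ‖(u : ℂ) / s * I‖ = |u| / s := by simp [abs_of_pos hs]
  have hz2 : ‖z - 1 - u / s * I‖ ≤ (|u| / s) ^ 2 := by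
    rw [← hnorm]
    exact norm_exp_sub_one_sub_id_le (by rw [hnorm]; exact (div_le_one hs).2 hus)
  have hz3 : ‖1 - z‖ ≤ |u| / s := by
    rw [norm_sub_rev, hz, ← ofReal_div, mul_comm]
    refine Real.norm_exp_I_mul_ofReal_sub_one_le.trans ?_
    rw [Real.norm_eq_abs, abs_div, abs_of_pos hs]
  have key : (m : ℂ) * z - (1 + c * m * z) * ((s ^ 2 - c' * s ^ 4) + u * s * I) =
      ((m - s ^ 2 : ℝ) : ℂ) * z + ((s ^ 2 : ℝ) : ℂ) * (z - 1 - u / s * I) +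
        (((c' - c) * s ^ 4 : ℝ) : ℂ) + ((c * s ^ 2 * (s ^ 2 - m) : ℝ) : ℂ) * z +
        ((c * s ^ 4 : ℝ) : ℂ) * (1 - z) + ((c * c' * m * s ^ 4 : ℝ) : ℂ) * z +
        ((-(u * s * c * m) : ℝ) : ℂ) * (I * z) := by
    push_cast
    field_simp
    ring
  rw [key]
  refine (norm_add_le_of_le (norm_add_le_of_le (norm_add_le_of_le (norm_add_le_of_le
    (norm_add_le_of_le (norm_add_le_of_le ?_ ?_) ?_) ?_) ?_) ?_) ?_)
  · rw [norm_mul, hz1, norm_real, Real.norm_eq_abs, mul_one]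
  · rw [norm_mul, norm_real, Real.norm_eq_abs, abs_of_nonneg (by positivity)]
    calc _ ≤ s ^ 2 * (|u| / s) ^ 2 := by gcongr
      _ = u ^ 2 := by rw [div_pow, sq_abs]; field_simp
  · rw [norm_real, Real.norm_eq_abs, abs_mul, abs_of_nonneg (by positivity : 0 ≤ s ^ 4)]
  · rw [norm_mul, hz1, norm_real, Real.norm_eq_abs, mul_one, abs_mul, abs_sub_comm,
      abs_of_nonneg (by positivity : 0 ≤ c * s ^ 2)]
  · rw [norm_mul, norm_real, Real.norm_eq_abs, abs_of_nonneg (by positivity)]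
    calc _ ≤ c * s ^ 4 * (|u| / s) := by gcongr
      _ = _ := by field_simp
  · rw [norm_mul, hz1, norm_real, Real.norm_eq_abs, mul_one, abs_of_nonneg (by positivity)]
  · rw [norm_mul, norm_mul, hz1, norm_I, norm_real, Real.norm_eq_abs, abs_neg, abs_mul, abs_mul,
      abs_mul, abs_of_pos hs, abs_of_nonneg hc, abs_of_nonneg hm]
    simp

/-- If `φ' + u φ` is small, then `φ` is close to the Gaussian characteristic function. -/
lemma norm_sub_gaussian_le {φ φ' : ℝ → ℂ} {ε U : ℝ} (hφ : ∀ u, HasDerivAt φ (φ' u) u)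
    (h0 : φ 0 = 1) (hU : ∀ u, |u| ≤ U → ‖φ' u + u * φ u‖ ≤ ε) {t : ℝ} (ht : |t| ≤ U) :
    ‖φ t - Real.exp (-(t ^ 2 / 2))‖ ≤ ε * |t| := by
  have hε : 0 ≤ ε := (norm_nonneg _).trans (hU t ht)
  have hexp : ∀ u : ℝ, HasDerivAt (fun u : ℝ => ((Real.exp (u ^ 2 / 2) : ℝ) : ℂ))
      ((Real.exp (u ^ 2 / 2) * u : ℝ) : ℂ) u := fun u => by
    refine HasDerivAt.ofReal_comp ?_
    have h : HasDerivAt (fun u : ℝ => u ^ 2 / 2) u u := by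
      simpa using (hasDerivAt_pow 2 u).div_const 2
    exact h.exp
  have hprod := fun u => (hφ u).mul (hexp u)
  have hb := Convex.norm_image_sub_le_of_norm_hasDerivWithin_le (C := ε * Real.exp (t ^ 2 / 2))
    (s := Set.Icc (-|t|) |t|) (x := 0) (y := t)
    (fun u _ => (hprod u).hasDerivWithinAt) (fun u hu => ?_) (convex_Icc _ _)
    (by simp) (by simp [neg_abs_le, le_abs_self])
  · have e : φ t - Real.exp (-(t ^ 2 / 2)) =
        (φ t * (Real.exp (t ^ 2 / 2) : ℝ) - 1) * (Real.exp (-(t ^ 2 / 2)) : ℝ) := by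
      have : ((Real.exp (t ^ 2 / 2) : ℝ) : ℂ) * (Real.exp (-(t ^ 2 / 2)) : ℝ) = 1 := by
        rw [← Complex.ofReal_mul, ← Real.exp_add]
        simp
      linear_combination (-φ t) * this
    have hb' : ‖φ t * (Real.exp (t ^ 2 / 2) : ℝ) - 1‖ ≤ ε * Real.exp (t ^ 2 / 2) * |t| := by
      simpa [h0] using hb
    rw [e, norm_mul, Complex.norm_real, Real.norm_eq_abs, Real.abs_exp]
    calc _ ≤ ε * Real.exp (t ^ 2 / 2) * |t| * Real.exp (-(t ^ 2 / 2)) := by gcongr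
      _ = ε * |t| * (Real.exp (t ^ 2 / 2) * Real.exp (-(t ^ 2 / 2))) := by ring
      _ = _ := by rw [← Real.exp_add]; simp
  · have hut : |u| ≤ |t| := abs_le.2 hu
    have e : φ' u * (Real.exp (u ^ 2 / 2) : ℝ) + φ u * ((Real.exp (u ^ 2 / 2) * u : ℝ) : ℂ) =
        (φ' u + u * φ u) * (Real.exp (u ^ 2 / 2) : ℝ) := by
      push_cast
      ring
    rw [e, norm_mul, Complex.norm_real, Real.norm_eq_abs, Real.abs_exp]
    have h1 : u ^ 2 ≤ t ^ 2 := sq_le_sq.2 hut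
    have h2 := hU u (hut.trans ht)
    gcongr

variable {ι : Type*} (L : Finset ι) (w : ι → ℝ) (k : ι → ℕ)

open Complex in
/-- If `k` satisfies an approximate Stein identity under the probability weights `w`, then the
characteristic function of its normalization almost solves `φ' = -u φ`. -/
lemma exists_hasDerivAt_norm_add_le (hw : ∀ i ∈ L, 0 ≤ w i) (hw1 : ∑ i ∈ L, w i = 1)
    {m c c' s η : ℝ} (hs : 0 < s) (hm : 0 ≤ m) (hc : 0 ≤ c) (hc' : 0 ≤ c') (hcm : c * m ≤ 1 / 2)
    (hstein : ∀ g : ℕ → ℂ, (∀ j, ‖g j‖ ≤ 1) →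
      ‖∑ i ∈ L, (w i : ℂ) * (k i * g (k i) - m * (1 - c * k i) * g (k i + 1))‖ ≤ η) :
    ∃ φ' : ℝ → ℂ, ∀ u : ℝ,
      HasDerivAt (fun u : ℝ => ∑ i ∈ L,
        (w i : ℂ) * cexp (u * (((k i - (s ^ 2 - c' * s ^ 4)) / s : ℝ) : ℂ) * I)) (φ' u) u ∧
      (|u| ≤ s → ‖φ' u + u * ∑ i ∈ L,
        (w i : ℂ) * cexp (u * (((k i - (s ^ 2 - c' * s ^ 4)) / s : ℝ) : ℂ) * I)‖ ≤
        2 / s * (η + (|m - s ^ 2| + u ^ 2 + |c' - c| * s ^ 4 + c * s ^ 2 * |m - s ^ 2| +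
          c * s ^ 3 * |u| + c * c' * m * s ^ 4 + |u| * s * c * m))) := by
  have hs' : (s : ℂ) ≠ 0 := by exact_mod_cast hs.ne'
  set x : ℕ → ℝ := fun j => (j - (s ^ 2 - c' * s ^ 4)) / s with hx
  refine ⟨fun u => ∑ i ∈ L, (w i : ℂ) * (cexp (u * (x (k i) : ℂ) * I) * (x (k i) * I)),
    fun u => ⟨?_, fun hus => ?_⟩⟩
  · refine HasDerivAt.fun_sum fun i _ => HasDerivAt.const_mul _ (HasDerivAt.cexp ?_)
    have h : HasDerivAt (fun u : ℝ => (u : ℂ)) 1 u := ofRealCLM.hasDerivAt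
    simpa only [mul_assoc, one_mul] using h.mul_const ((x (k i) : ℂ) * I)
  · set g : ℕ → ℂ := fun j => cexp (u * (x j : ℂ) * I) with hg
    set z : ℂ := cexp (u / s * I) with hz
    have hg1 : ∀ j, ‖g j‖ = 1 := fun j => by
      rw [hg]
      simp only [← ofReal_mul]
      exact norm_exp_ofReal_mul_I _
    have hgz : ∀ j, g (j + 1) = z * g j := fun j => by
      rw [hg, hz]
      simp only [← Complex.exp_add, hx]
      congr 1
      push_cast
      field_simp
      ring
    have hz1 : ‖z‖ = 1 := by
      rw [hz, ← ofReal_div]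
      exact norm_exp_ofReal_mul_I _
    set φ : ℂ := ∑ i ∈ L, (w i : ℂ) * g (k i) with hφ
    set S : ℂ := ∑ i ∈ L, (w i : ℂ) * (k i * g (k i)) with hS
    have hφ1 : ‖φ‖ ≤ 1 := by
      refine (norm_sum_le_of_le _ fun i hi => ?_).trans hw1.le
      rw [norm_mul, hg1, mul_one, Complex.norm_of_nonneg (hw i hi)]
    have hst := hstein g fun j => (hg1 j).le
    have e1 : ∑ i ∈ L, (w i : ℂ) * (k i * g (k i) - m * (1 - c * k i) * g (k i + 1)) =
        (1 + c * m * z) * S - m * z * φ := by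
      simp only [hgz, hS, hφ, mul_sum, ← sum_sub_distrib]
      exact sum_congr rfl fun i _ => by ring
    rw [e1] at hst
    have hdrift := norm_drift_sub_le hs hus hm hc hc'
    rw [← hz] at hdrift
    set K := |m - s ^ 2| + u ^ 2 + |c' - c| * s ^ 4 + c * s ^ 2 * |m - s ^ 2| +
          c * s ^ 3 * |u| + c * c' * m * s ^ 4 + |u| * s * c * m
    set b : ℂ := (s ^ 2 - c' * s ^ 4) + u * s * I with hb
    have e2 : ∑ i ∈ L, (w i : ℂ) * (cexp (u * (x (k i) : ℂ) * I) * (x (k i) * I)) + u * φ =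
        I / s * (S - b * φ) := by
      have : ∑ i ∈ L, (w i : ℂ) * (cexp (u * (x (k i) : ℂ) * I) * (x (k i) * I)) =
          I / s * (S - (s ^ 2 - c' * s ^ 4) * φ) := by
        simp only [hS, hφ, mul_sum, ← sum_sub_distrib]
        refine sum_congr rfl fun i _ => ?_
        simp only [hx, hg]
        push_cast
        ring
      rw [this, hb]
      field_simp
      linear_combination ((u : ℂ) * s * φ) * I_sq
    have h1 : ‖(1 + c * m * z) * (S - b * φ)‖ ≤ η + K := by
      have e3 : (1 + c * m * z) * (S - b * φ) =
          ((1 + c * m * z) * S - m * z * φ) + (m * z - (1 + c * m * z) * b) * φ := by ring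
      rw [e3]
      refine norm_add_le_of_le hst ?_
      rw [norm_mul]
      exact (mul_le_of_le_one_right (norm_nonneg _) hφ1).trans hdrift
    have h2 : 1 / 2 ≤ ‖1 + c * m * z‖ := by
      have h3 : ‖(c * m * z : ℂ)‖ = c * m := by
        rw [norm_mul, hz1, mul_one, ← ofReal_mul, Complex.norm_of_nonneg (by positivity)]
      have h4 := norm_sub_le (1 + c * m * z : ℂ) (c * m * z)
      rw [add_sub_cancel_right, norm_one, h3] at h4
      linarith
    rw [norm_mul] at h1
    change ‖_ + u * φ‖ ≤ _
    rw [e2, norm_mul, norm_div, norm_I, norm_real, Real.norm_eq_abs, abs_of_pos hs]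
    have h5 : ‖S - b * φ‖ ≤ 2 * (η + K) := by
      nlinarith [norm_nonneg (S - b * φ)]
    calc _ ≤ 1 / s * (2 * (η + K)) := by gcongr
      _ = _ := by ring

end CharacteristicFunction

section ConditionedLaw

lemma filter_isLinear_eq (n r : ℕ) :
    Finset.univ.filter (fun H : Finset (Finset (Fin n)) => (∀ e ∈ H, e.card = r) ∧ IsLinear H) =
      indepSets (powersetCard r univ) (fun e f : Finset (Fin n) => 2 ≤ (e ∩ f).card) := by
  ext H
  simp only [indepSets, mem_filter, mem_univ, true_and, mem_powerset, subset_iff,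
    mem_powersetCard, not_le, Nat.lt_succ_iff]
  simp [IsLinear]

lemma card_le_choose_of_mem_indepSets {n r : ℕ} {C : Finset (Fin n) → Finset (Fin n) → Prop}
    [DecidableRel C] {H : Finset (Finset (Fin n))} (hH : H ∈ indepSets (powersetCard r univ) C) :
    H.card ≤ n.choose r := by
  simpa using card_le_card (subset_of_mem_indepSets hH)

lemma sum_indepSets_pow_pos {α : Type*} [DecidableEq α] (V : Finset α) (C : α → α → Prop)
    [DecidableRel C] {l : ℝ} (hl : 0 ≤ l) : 0 < ∑ H ∈ indepSets V C, l ^ H.card :=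
  sum_pos' (fun _ _ => pow_nonneg hl _) ⟨∅, by simp [indepSets], by simp⟩

lemma weight_eq {N k : ℕ} (hk : k ≤ N) {p : ℝ} (hp1 : p < 1) :
    p ^ k * (1 - p) ^ (N - k) = (1 - p) ^ N * (p / (1 - p)) ^ k := by
  have h : 1 - p ≠ 0 := by linarith
  rw [div_pow, ← Nat.sub_add_cancel hk, pow_add, Nat.add_sub_cancel]
  field_simp

lemma probLinear_eq (n r : ℕ) {p : ℝ} (hp1 : p < 1) :
    probLinear n r p = (1 - p) ^ n.choose r *
      ∑ H ∈ indepSets (powersetCard r univ) (fun e f : Finset (Fin n) => 2 ≤ (e ∩ f).card),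
        (p / (1 - p)) ^ H.card := by
  rw [probLinear, filter_isLinear_eq, mul_sum]
  exact sum_congr rfl fun H hH => weight_eq (card_le_choose_of_mem_indepSets hH) hp1

lemma probLinear_pos (n r : ℕ) {p : ℝ} (hp0 : 0 ≤ p) (hp1 : p < 1) : 0 < probLinear n r p := by
  rw [probLinear_eq n r hp1]
  have h : 0 < 1 - p := by linarith
  have := sum_indepSets_pow_pos (powersetCard r univ)
    (fun e f : Finset (Fin n) => 2 ≤ (e ∩ f).card) (div_nonneg hp0 h.le)
  positivity

lemma isProbabilityMeasure_condEdgeLaw (n r : ℕ) {p : ℝ} (hp0 : 0 ≤ p) (hp1 : p < 1) (a b : ℝ) :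
    IsProbabilityMeasure (condEdgeLaw n r p a b) := by
  have hpos := probLinear_pos n r hp0 hp1
  have h : 0 ≤ 1 - p := by linarith
  constructor
  rw [condEdgeLaw, Measure.smul_apply, Measure.finsetSum_apply]
  simp only [Measure.smul_apply, measure_univ, smul_eq_mul, mul_one]
  rw [← ENNReal.ofReal_sum_of_nonneg fun H _ => by positivity]
  exact ENNReal.inv_mul_cancel (by simpa using hpos) ENNReal.ofReal_ne_top

lemma charFun_condEdgeLaw (n r : ℕ) {p : ℝ} (hp0 : 0 ≤ p) (hp1 : p < 1) (a b t : ℝ) :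
    charFun (condEdgeLaw n r p a b) t =
      ∑ H ∈ indepSets (powersetCard r univ) (fun e f : Finset (Fin n) => 2 ≤ (e ∩ f).card),
        (((p / (1 - p)) ^ H.card /
          ∑ H ∈ indepSets (powersetCard r univ) (fun e f : Finset (Fin n) => 2 ≤ (e ∩ f).card),
            (p / (1 - p)) ^ H.card : ℝ) : ℂ) *
          Complex.exp (t * (((H.card - a) / b : ℝ) : ℂ) * Complex.I) := by
  have hpos := probLinear_pos n r hp0 hp1
  have h : 0 < 1 - p := by linarith
  rw [charFun_apply_real, condEdgeLaw, integral_smul_measure, integral_finsetSum_measure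
    fun H _ => (integrable_dirac (by simp)).smul_measure ENNReal.ofReal_ne_top,
    filter_isLinear_eq, smul_sum]
  refine sum_congr rfl fun H hH => ?_
  rw [integral_smul_measure, integral_dirac, smul_smul, ENNReal.toReal_inv,
    ENNReal.toReal_ofReal hpos.le, ENNReal.toReal_ofReal (by positivity),
    weight_eq (card_le_choose_of_mem_indepSets hH) hp1, probLinear_eq n r hp1, Complex.real_smul]
  congr 2
  field_simp

end ConditionedLaw

section Estimates

lemma choose_two_sq_div_choose_two {n r : ℕ} :
    (r.choose 2 : ℝ) ^ 2 / n.choose 2 = (r * (r - 1)) ^ 2 / (2 * (n * (n - 1))) := by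
  rw [Nat.cast_choose_two, Nat.cast_choose_two, div_pow, div_div_div_eq, mul_comm _ (2 : ℝ),
    sq (2 : ℝ), mul_assoc, mul_div_mul_left _ _ two_ne_zero]

lemma cast_choose_three (n : ℕ) (hn : 3 ≤ n) :
    (n.choose 3 : ℝ) = n * (n - 1) * (n - 2) / 6 := by
  obtain ⟨k, rfl⟩ := Nat.exists_eq_add_of_le' hn
  have h1 : ((k + 3).choose 3 * 3 : ℝ) = (k + 3).choose 2 * (k + 1) := by
    exact_mod_cast Nat.choose_succ_right_eq (k + 3) 2
  rw [Nat.cast_choose_two] at h1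
  push_cast at h1 ⊢
  linarith

lemma choose_two_sq_div_le {n r : ℕ} (hr : 3 ≤ r) (hn : r ≤ n) :
    (r.choose 2 : ℝ) ^ 2 / n.choose 2 ≤ (r ^ 2 / n : ℝ) ^ 2 := by
  have hr' : (3 : ℝ) ≤ r := by exact_mod_cast hr
  have hn' : (r : ℝ) ≤ n := by exact_mod_cast hn
  rw [choose_two_sq_div_choose_two, div_pow, ← pow_mul,
    div_le_div_iff₀ (by nlinarith) (by nlinarith)]
  have h1 : ((r : ℝ) * (r - 1)) ^ 2 ≤ r ^ (2 * 2) := by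
    have : (r : ℝ) * (r - 1) ≤ r ^ 2 := by nlinarith
    calc _ ≤ ((r : ℝ) ^ 2) ^ 2 := pow_le_pow_left₀ (by nlinarith) this 2
      _ = _ := by ring
  exact mul_le_mul h1 (by nlinarith) (by positivity) (by positivity)

lemma descFactorial_sq_div_le {n r : ℕ} (hr : 3 ≤ r) (hn : r ≤ n) :
    (r.descFactorial 2 : ℝ) ^ 2 / (2 * n ^ 2) ≤ (r.choose 2 : ℝ) ^ 2 / n.choose 2 ∧
    (r.choose 2 : ℝ) ^ 2 / n.choose 2 - (r.descFactorial 2 : ℝ) ^ 2 / (2 * n ^ 2) ≤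
      (r ^ 2 / n : ℝ) ^ 3 := by
  have hr' : (3 : ℝ) ≤ r := by exact_mod_cast hr
  have hn' : (r : ℝ) ≤ n := by exact_mod_cast hn
  have hd : (r.descFactorial 2 : ℝ) = r * (r - 1) := by
    rw [Nat.cast_descFactorial_two]
  have e : (r.choose 2 : ℝ) ^ 2 / n.choose 2 - (r.descFactorial 2 : ℝ) ^ 2 / (2 * n ^ 2) =
      (r.choose 2 : ℝ) ^ 2 / n.choose 2 * (1 / n) := by
    have h1 : (n : ℝ) ≠ 0 := by linarith
    have h2 : (n : ℝ) - 1 ≠ 0 := by linarith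
    rw [choose_two_sq_div_choose_two, hd]
    field_simp
    ring
  refine ⟨?_, ?_⟩
  · have : 0 ≤ (r.choose 2 : ℝ) ^ 2 / n.choose 2 * (1 / n) := by positivity
    linarith
  · rw [e, pow_succ ((r : ℝ) ^ 2 / n) 2]
    refine mul_le_mul (choose_two_sq_div_le hr hn) ?_ (by positivity) (by positivity)
    gcongr
    nlinarith

lemma choose_three_sq_div_le {n r : ℕ} (hr : 3 ≤ r) (hn : r < n) :
    2 * ((r.choose 3 : ℝ) ^ 2 / n.choose 3) ≤ (r ^ 2 / n : ℝ) ^ 3 := by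
  have hr' : (3 : ℝ) ≤ r := by exact_mod_cast hr
  have hn' : (r : ℝ) + 1 ≤ n := by exact_mod_cast hn
  have hn0 : (0 : ℝ) < n := by linarith
  have e : ∀ a b : ℝ, 2 * ((a / 6) ^ 2 / (b / 6)) = a ^ 2 / (3 * b) := fun a b => by
    rw [div_pow, div_div_div_eq, mul_comm _ (6 : ℝ), sq (6 : ℝ), mul_assoc,
      mul_div_mul_left _ _ (by norm_num), ← mul_div_assoc, show (6 : ℝ) = 2 * 3 by norm_num,
      mul_assoc, mul_div_mul_left _ _ two_ne_zero]
  have hB : 0 < (n : ℝ) * (n - 1) * (n - 2) := by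
    exact mul_pos (mul_pos hn0 (by linarith)) (by linarith)
  rw [cast_choose_three r hr, cast_choose_three n (by omega), e, div_pow, ← pow_mul,
    div_le_div_iff₀ (by positivity) (by positivity)]
  have h1 : (r : ℝ) * (r - 1) * (r - 2) ≤ r ^ 3 := by
    rw [mul_assoc, pow_succ', pow_two]
    gcongr <;> linarith
  have h1' : 0 ≤ (r : ℝ) * (r - 1) * (r - 2) := by
    have : 0 ≤ ((r : ℝ) - 1) * (r - 2) := by nlinarith
    rw [mul_assoc]; positivity
  have h2 : (n : ℝ) ^ 3 / 3 ≤ n * (n - 1) * (n - 2) := by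
    have : (n : ℝ) ^ 2 / 3 ≤ (n - 1) * (n - 2) := by nlinarith
    nlinarith
  have h3 : ((r : ℝ) * (r - 1) * (r - 2)) ^ 2 ≤ r ^ 6 :=
    (pow_le_pow_left₀ h1' h1 2).trans (le_of_eq (by ring))
  calc _ = ((r : ℝ) * (r - 1) * (r - 2)) ^ 2 * (n ^ 3 / 3) * 3 := by ring
    _ ≤ r ^ 6 * (n * (n - 1) * (n - 2)) * 3 := by gcongr
    _ = _ := by ring

lemma inv_choose_le {n r : ℕ} (hr : 3 ≤ r) (hn : r < n) :
    1 / (n.choose r : ℝ) ≤ (r ^ 2 / n : ℝ) ^ 3 := by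
  refine le_trans ?_ (choose_three_sq_div_le hr hn)
  have h : n.choose r * r.choose 3 = n.choose 3 * (n - 3).choose (r - 3) := Nat.choose_mul hr
  have h1 : n.choose 3 ≤ n.choose r * r.choose 3 := by
    rw [h]
    exact Nat.le_mul_of_pos_right _ (Nat.choose_pos (by omega))
  have h2 : (n.choose 3 : ℝ) ≤ n.choose r * r.choose 3 := by exact_mod_cast h1
  have h3 : (1 : ℝ) ≤ r.choose 3 := by exact_mod_cast Nat.choose_pos hr
  have h4 : (0 : ℝ) < n.choose 3 := by exact_mod_cast Nat.choose_pos (by omega)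
  have h5 : (0 : ℝ) < n.choose r := by exact_mod_cast Nat.choose_pos hn.le
  rw [← mul_div_assoc, div_le_div_iff₀ h5 h4]
  nlinarith [mul_pos h5 (zero_lt_one.trans_le h3)]

/-- The error term of the characteristic function is controlled by `κ = s y ^ 3`. -/
lemma error_le {s y U c c' m η : ℝ} (hs : 0 < s) (hy : 0 ≤ y) (hsy : 1 ≤ s * y ^ 2)
    (hk : s * y ^ 3 ≤ 1 / 2) (hU : 0 ≤ U) (hc : 0 ≤ c) (hc' : 0 ≤ c') (hcy : c ≤ y ^ 8)
    (hcy' : c' ≤ y ^ 8) (hcc : |c' - c| ≤ y ^ 12) (hm : 0 ≤ m)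
    (hms : |m - s ^ 2| ≤ 2 * s ^ 4 * y ^ 12) (hm2 : m ≤ 2 * s ^ 2)
    (hη : η ≤ m ^ 2 * y ^ 12 + m ^ 3 * c ^ 2) :
    2 / s * (η + (|m - s ^ 2| + U ^ 2 + |c' - c| * s ^ 4 + c * s ^ 2 * |m - s ^ 2| +
      c * s ^ 3 * U + c * c' * m * s ^ 4 + U * s * c * m)) ≤
      2 * (s * y ^ 3) * (21 + 3 * U + U ^ 2) := by
  set κ := s * y ^ 3 with hκ
  have hκ0 : 0 ≤ κ := by positivity
  have hκ1 : κ ≤ 1 := by linarith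
  have hyκ : y ≤ κ := by
    have := mul_le_mul_of_nonneg_right hsy hy
    rw [hκ]
    linarith
  have hy1 : y ≤ 1 := hyκ.trans hκ1
  have hsum : η + (|m - s ^ 2| + U ^ 2 + |c' - c| * s ^ 4 + c * s ^ 2 * |m - s ^ 2| +
      c * s ^ 3 * U + c * c' * m * s ^ 4 + U * s * c * m) ≤
      ((2 * s ^ 2) ^ 2 * y ^ 12 + (2 * s ^ 2) ^ 3 * (y ^ 8) ^ 2) + (2 * s ^ 4 * y ^ 12 +
      U ^ 2 * (s * y ^ 2) +
      y ^ 12 * s ^ 4 + y ^ 8 * s ^ 2 * (2 * s ^ 4 * y ^ 12) + y ^ 8 * s ^ 3 * U +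
      y ^ 8 * y ^ 8 * (2 * s ^ 2) * s ^ 4 + U * s * y ^ 8 * (2 * s ^ 2)) := by
    have h1 : η ≤ (2 * s ^ 2) ^ 2 * y ^ 12 + (2 * s ^ 2) ^ 3 * (y ^ 8) ^ 2 :=
      hη.trans (by gcongr)
    have h2 : U ^ 2 ≤ U ^ 2 * (s * y ^ 2) := le_mul_of_one_le_right (sq_nonneg U) hsy
    gcongr
  have hpow : ∀ j i : ℕ, 1 ≤ j + i → κ ^ j * y ^ i ≤ κ := by
    intro j i hji
    rcases Nat.eq_zero_or_pos j with rfl | hj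
    · have hi : i ≠ 0 := by omega
      rw [pow_zero, one_mul]
      exact (pow_le_of_le_one hy hy1 hi).trans hyκ
    · calc κ ^ j * y ^ i ≤ κ * 1 := by
            gcongr
            · exact pow_le_of_le_one hκ0 hκ1 hj.ne'
            · exact pow_le_one₀ hy hy1
        _ = κ := mul_one _
  have hU2 : 0 ≤ U ^ 2 := sq_nonneg U
  calc _ ≤ 2 / s * (((2 * s ^ 2) ^ 2 * y ^ 12 + (2 * s ^ 2) ^ 3 * (y ^ 8) ^ 2) +
      (2 * s ^ 4 * y ^ 12 + U ^ 2 * (s * y ^ 2) +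
      y ^ 12 * s ^ 4 + y ^ 8 * s ^ 2 * (2 * s ^ 4 * y ^ 12) + y ^ 8 * s ^ 3 * U +
      y ^ 8 * y ^ 8 * (2 * s ^ 2) * s ^ 4 + U * s * y ^ 8 * (2 * s ^ 2))) := by gcongr
    _ = 2 * (7 * (κ ^ 3 * y ^ 3) + 10 * (κ ^ 5 * y ^ 1) + 2 * (κ ^ 5 * y ^ 5) +
        3 * U * (κ ^ 2 * y ^ 2) + U ^ 2 * (κ ^ 0 * y ^ 2)) := by
      rw [hκ]
      field_simp
      ring
    _ ≤ 2 * (7 * κ + 10 * κ + 2 * κ + 3 * U * κ + U ^ 2 * κ) := by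
      gcongr <;> exact hpow _ _ (by norm_num)
    _ ≤ _ := by nlinarith

end Estimates

section Convergence

lemma stein_condEdgeLaw {n r : ℕ} (hr : 3 ≤ r) (hrn : r ≤ n) {l c δ : ℝ} (hl : 0 ≤ l)
    (hc : c = (r.choose 2 : ℝ) ^ 2 / n.choose 2)
    (hδ : δ = 2 * ((r.choose 3 : ℝ) ^ 2 / n.choose 3)) (g : ℕ → ℂ) (hg : ∀ j, ‖g j‖ ≤ 1) :
    ‖∑ H ∈ indepSets (powersetCard r univ) (fun e f : Finset (Fin n) => 2 ≤ (e ∩ f).card),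
        ((l ^ H.card /
          ∑ H ∈ indepSets (powersetCard r univ) (fun e f : Finset (Fin n) => 2 ≤ (e ∩ f).card),
            l ^ H.card : ℝ) : ℂ) *
          (H.card * g H.card - ((l * n.choose r : ℝ) : ℂ) * (1 - c * H.card) * g (H.card + 1))‖ ≤
      (l * n.choose r) ^ 2 * δ + (l * n.choose r) ^ 3 * c ^ 2 := by
  set V := powersetCard r (univ : Finset (Fin n)) with hV
  set C := fun e f : Finset (Fin n) => 2 ≤ (e ∩ f).card with hC
  set Z := ∑ H ∈ indepSets V C, l ^ H.card with hZ
  have hZ0 : 0 < Z := sum_indepSets_pow_pos V C hl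
  have hcard : (V.card : ℝ) = n.choose r := by simp [hV]
  have hT := choose_mul_choose_sub_eq (k := 2) (by omega) hrn
  have hD := choose_mul_choose_sub_eq (k := 3) hr hrn
  rw [← hc] at hT
  have hδ' : δ * n.choose r = 2 * (r.choose 3 * (n - 3).choose (r - 3) : ℝ) := by
    rw [hD, hδ]
    ring
  have hmem : ∀ f ∈ V, f.card = r := fun f hf => (mem_powersetCard.1 hf).2
  have h := norm_sum_stein_le (V := V) (C := C) (T := c * n.choose r) (D := δ * n.choose r)
    (fun e he => by simp only [hC, inter_self, hmem e he]; omega)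
    (fun e f h => by simpa only [hC, inter_comm] using h) hl
    (fun f hf => by rw [← hT]; exact_mod_cast card_filter_le_choose hr (hmem f hf))
    (by rw [hδ]; positivity)
    (fun f hf => by
      have h : (r.choose 2 * (n - 2).choose (r - 2) : ℝ) ≤
          (V.filter fun e => C e f).card + 2 * (r.choose 3 * (n - 3).choose (r - 3)) := by
        exact_mod_cast choose_le_card_filter hr (hmem f hf)
      rw [← hT, hδ']
      linarith) g hg
  have hcard' : (V.card : ℂ) = n.choose r := by exact_mod_cast hcard
  rw [hcard, hcard', ← hZ] at h
  have e : ∑ H ∈ indepSets V C, ((l ^ H.card / Z : ℝ) : ℂ) *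
      (H.card * g H.card - ((l * n.choose r : ℝ) : ℂ) * (1 - c * H.card) * g (H.card + 1)) =
      ((Z⁻¹ : ℝ) : ℂ) * ∑ H ∈ indepSets V C, (l : ℂ) ^ H.card * (H.card * g H.card -
        l * (n.choose r - ((c * n.choose r : ℝ) : ℂ) * H.card) * g (H.card + 1)) := by
    rw [mul_sum]
    refine sum_congr rfl fun H _ => ?_
    push_cast
    ring
  rw [e, norm_mul, Complex.norm_of_nonneg (by positivity)]
  calc _ ≤ Z⁻¹ * (l * (l * n.choose r * (δ * n.choose r) +
        l ^ 2 * n.choose r * (c * n.choose r) ^ 2) * Z) := by gcongr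
    _ = _ := by
      field_simp

/-- Quantitative closeness of the characteristic function of the conditioned law to the Gaussian
one, in terms of `s = √(N p)` and `y = (r ^ 2 / n) ^ (1 / 4)`. -/
lemma norm_charFun_condEdgeLaw_sub_le {n r : ℕ} {p s y t : ℝ} (hr : 3 ≤ r) (hn : 0 < n)
    (hp0 : 0 ≤ p) (hs : 0 < s) (hsp : s ^ 2 = n.choose r * p) (hy : 0 ≤ y)
    (hy4 : y ^ 4 = r ^ 2 / n) (hsy : 1 ≤ s * y ^ 2) (hk : s * y ^ 3 ≤ 1 / 2) (ht : |t| ≤ s) :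
    p < 1 ∧ ‖charFun (condEdgeLaw n r p
        (s ^ 2 - (r.descFactorial 2 : ℝ) ^ 2 / (2 * n ^ 2) * s ^ 4) s) t -
        Real.exp (-(t ^ 2 / 2))‖ ≤ 2 * (s * y ^ 3) * (21 + 3 * |t| + |t| ^ 2) * |t| := by
  have hyk : y ≤ s * y ^ 3 := by
    have := mul_le_mul_of_nonneg_right hsy hy
    linarith
  have hy2 : y ≤ 1 / 2 := hyk.trans hk
  have hn0 : (0 : ℝ) < n := by exact_mod_cast hn
  have hr0 : (3 : ℝ) ≤ r := by exact_mod_cast hr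
  have hrn : r < n := by
    have h1 : y ^ 4 ≤ (1 / 2) ^ 4 := pow_le_pow_left₀ hy hy2 4
    rw [hy4, div_le_iff₀ hn0] at h1
    have : (r : ℝ) < n := by nlinarith
    exact_mod_cast this
  have hy8 : (r ^ 2 / n : ℝ) ^ 2 = y ^ 8 := by rw [← hy4]; ring
  have hy12 : (r ^ 2 / n : ℝ) ^ 3 = y ^ 12 := by rw [← hy4]; ring
  have hN : (0 : ℝ) < n.choose r := by exact_mod_cast Nat.choose_pos hrn.le
  have hpN : p = s ^ 2 * (1 / n.choose r) := by
    rw [hsp]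
    field_simp
  have hNy := inv_choose_le hr hrn
  rw [hy12] at hNy
  have hpy : p ≤ s ^ 2 * y ^ 12 := by rw [hpN]; gcongr
  have hp2 : p ≤ 1 / 2 := by
    have h1 : s ^ 2 * y ^ 12 = (s * y ^ 3) ^ 2 * y ^ 6 := by ring
    have h2 : (s * y ^ 3) ^ 2 * y ^ 6 ≤ (1 / 2) ^ 2 * (1 / 2) ^ 6 := by gcongr
    linarith
  have hp1 : p < 1 := by linarith
  refine ⟨hp1, ?_⟩
  have hq : 0 < 1 - p := by linarith
  set l := p / (1 - p) with hl
  have hl0 : 0 ≤ l := div_nonneg hp0 hq.le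
  have hl2 : l ≤ 2 * p := by
    rw [hl, div_le_iff₀ hq]
    nlinarith
  set c := (r.choose 2 : ℝ) ^ 2 / n.choose 2 with hc
  set c' := (r.descFactorial 2 : ℝ) ^ 2 / (2 * n ^ 2) with hc'
  set δ := 2 * ((r.choose 3 : ℝ) ^ 2 / n.choose 3) with hδ
  set m := l * n.choose r with hm
  have hc0 : 0 ≤ c := by positivity
  have hc'0 : 0 ≤ c' := by positivity
  have hm0 : 0 ≤ m := by positivity
  have hcy : c ≤ y ^ 8 := (choose_two_sq_div_le hr hrn.le).trans hy8.le
  obtain ⟨hcc1, hcc2⟩ := descFactorial_sq_div_le hr hrn.le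
  rw [hy12] at hcc2
  have hδy : δ ≤ y ^ 12 := (choose_three_sq_div_le hr hrn).trans hy12.le
  have hm2 : m ≤ 2 * s ^ 2 := by
    rw [hsp, hm]
    nlinarith
  have hms : |m - s ^ 2| ≤ 2 * s ^ 4 * y ^ 12 := by
    have e : m - s ^ 2 = s ^ 2 * l := by
      rw [hsp, hm, hl]
      field_simp
      ring
    rw [e, abs_of_nonneg (by positivity)]
    calc s ^ 2 * l ≤ s ^ 2 * (2 * (s ^ 2 * y ^ 12)) := by
          gcongr
          linarith
      _ = _ := by ring
  have hcm : c * m ≤ 1 / 2 := by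
    calc c * m ≤ y ^ 8 * (2 * s ^ 2) := by gcongr
      _ = 2 * (s * y ^ 3) ^ 2 * y ^ 2 := by ring
      _ ≤ 2 * (1 / 2) ^ 2 * (1 / 2) ^ 2 := by gcongr
      _ ≤ 1 / 2 := by norm_num
  have hZ := sum_indepSets_pow_pos (powersetCard r univ)
    (fun e f : Finset (Fin n) => 2 ≤ (e ∩ f).card) hl0
  obtain ⟨φ', hφ'⟩ := exists_hasDerivAt_norm_add_le
    (indepSets (powersetCard r univ) (fun e f : Finset (Fin n) => 2 ≤ (e ∩ f).card))
    (fun H => l ^ H.card /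
      ∑ H ∈ indepSets (powersetCard r univ) (fun e f : Finset (Fin n) => 2 ≤ (e ∩ f).card),
        l ^ H.card)
    (fun H => H.card) (fun H _ => by positivity)
    (by rw [← sum_div, div_self hZ.ne']) hs hm0 hc0 hc'0 hcm
    (stein_condEdgeLaw hr hrn.le hl0 hc hδ)
  rw [charFun_condEdgeLaw n r hp0 hp1]
  refine norm_sub_gaussian_le (U := |t|) (fun u => (hφ' u).1) ?_ (fun u hu => ?_) le_rfl
  · simp only [Complex.ofReal_zero, zero_mul, Complex.exp_zero, mul_one]
    rw [← Complex.ofReal_sum, ← sum_div, div_self hZ.ne', Complex.ofReal_one]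
  · refine ((hφ' u).2 (hu.trans ht)).trans (le_trans ?_ (error_le hs hy hsy hk (abs_nonneg t) hc0
      hc'0 hcy (hcc1.trans hcy) (c := c) (c' := c') ?_ hm0 hms hm2
      (η := m ^ 2 * δ + m ^ 3 * c ^ 2) ?_))
    · have hu2 : u ^ 2 ≤ |t| ^ 2 := by rw [← sq_abs u]; gcongr
      gcongr
    · rw [abs_sub_comm, abs_of_nonneg (by linarith)]
      exact hcc2
    · gcongr

lemma tendsto_integral_of_tendsto_charFun {P : ℕ → Measure ℝ} {Q : Measure ℝ}
    [IsProbabilityMeasure Q] (hP : ∀ᶠ n in atTop, IsProbabilityMeasure (P n))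
    (h : ∀ t, Tendsto (fun n => charFun (P n) t) atTop (nhds (charFun Q t)))
    (f : BoundedContinuousFunction ℝ ℝ) :
    Tendsto (fun n => ∫ x, f x ∂(P n)) atTop (nhds (∫ x, f x ∂Q)) := by
  classical
  let Q' : ProbabilityMeasure ℝ := ⟨Q, inferInstance⟩
  let R : ℕ → ProbabilityMeasure ℝ := fun n =>
    if hn : IsProbabilityMeasure (P n) then ⟨P n, hn⟩ else Q'
  have hR : ∀ᶠ n in atTop, (R n : Measure ℝ) = P n := by
    filter_upwards [hP] with n hn
    simp [R, hn]
  have hlim : Tendsto R atTop (nhds Q') := by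
    rw [ProbabilityMeasure.tendsto_iff_tendsto_charFun]
    intro t
    refine (h t).congr' ?_
    filter_upwards [hR] with n hn
    rw [hn]
  rw [ProbabilityMeasure.tendsto_iff_forall_integral_tendsto] at hlim
  refine (hlim f).congr' ?_
  filter_upwards [hR] with n hn
  rw [hn]

end Convergence

/-- **Corollary 1.4**: when `r⁻²n ≤ m₀ = Np = o(r⁻³n^{3/2})`, the number of edges of `H_r(n,p)`
conditioned on linearity, centred at `m₀ - [r]₂²m₀²/(2n²)` and scaled by `√m₀`, converges in
distribution to the standard normal distribution. -/
theorem statement2 (r : ℕ → ℕ) (p : ℕ → ℝ) (hr : ∀ n, 3 ≤ r n)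
    (hp0 : ∀ n, 0 ≤ p n) (hp1 : ∀ n, p n ≤ 1)
    (hlb : ∀ᶠ n : ℕ in atTop, (n : ℝ) / (r n : ℝ) ^ 2 ≤ expEdges r p n)
    (hsmall : (fun n => expEdges r p n) =o[atTop]
      (fun n => (n : ℝ) ^ ((3 : ℝ) / 2) / (r n : ℝ) ^ 3)) :
    ∀ f : BoundedContinuousFunction ℝ ℝ,
      Tendsto (fun n => ∫ x, f x ∂(condEdgeLaw n (r n) (p n)
          (expEdges r p n - ((r n).descFactorial 2 : ℝ) ^ 2 * (expEdges r p n) ^ 2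
            / (2 * (n : ℝ) ^ 2))
          (Real.sqrt (expEdges r p n))))
        atTop (nhds (∫ x, f x ∂(gaussianReal 0 1))) := by
  set s : ℕ → ℝ := fun n => √(expEdges r p n) with hs
  set y : ℕ → ℝ := fun n => √√((r n : ℝ) ^ 2 / n) with hy
  have hE : ∀ n, 0 ≤ expEdges r p n := fun n => mul_nonneg (Nat.cast_nonneg _) (hp0 n)
  have hs2 : ∀ n, s n ^ 2 = expEdges r p n := fun n => Real.sq_sqrt (hE n)
  have hy2 : ∀ n, y n ^ 2 = √((r n : ℝ) ^ 2 / n) := fun n => Real.sq_sqrt (Real.sqrt_nonneg _)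
  have hy4 : ∀ n, y n ^ 4 = (r n : ℝ) ^ 2 / n := fun n => by
    rw [show 4 = 2 * 2 from rfl, pow_mul, hy2, Real.sq_sqrt (by positivity)]
  have hκ : Tendsto (fun n => s n * y n ^ 3) atTop (nhds 0) := by
    have h1 := hsmall.tendsto_div_nhds_zero
    have h2 : Tendsto (fun n => √(expEdges r p n / ((n : ℝ) ^ ((3 : ℝ) / 2) / (r n : ℝ) ^ 3)))
        atTop (nhds 0) := by simpa using h1.sqrt
    refine h2.congr' ?_
    filter_upwards [eventually_gt_atTop 0] with n hn
    have hn0 : (0 : ℝ) < n := by exact_mod_cast hn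
    have hr0 : (0 : ℝ) < r n := by exact_mod_cast (by have := hr n; omega : 0 < r n)
    have h3 : (n : ℝ) ^ ((3 : ℝ) / 2) = √n ^ 3 := by
      rw [Real.sqrt_eq_rpow, ← Real.rpow_natCast, ← Real.rpow_mul hn0.le]
      norm_num
    have h4 : y n ^ 2 = r n / √n := by
      rw [hy2, Real.sqrt_div (sq_nonneg _), Real.sqrt_sq hr0.le]
    have h5 : expEdges r p n / ((n : ℝ) ^ ((3 : ℝ) / 2) / (r n : ℝ) ^ 3) =
        (s n * y n ^ 3) ^ 2 := by
      rw [mul_pow, hs2, ← pow_mul, mul_comm 3 2, pow_mul, h4, h3]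
      field_simp
    rw [h5, Real.sqrt_sq (mul_nonneg (Real.sqrt_nonneg _) (pow_nonneg (Real.sqrt_nonneg _) _))]
  have hmain : ∀ t : ℝ, ∀ᶠ n in atTop, p n < 1 ∧ ‖charFun (condEdgeLaw n (r n) (p n)
      (expEdges r p n - ((r n).descFactorial 2 : ℝ) ^ 2 * (expEdges r p n) ^ 2
            / (2 * (n : ℝ) ^ 2)) (s n)) t - Real.exp (-(t ^ 2 / 2))‖ ≤
      2 * (s n * y n ^ 3) * (21 + 3 * |t| + |t| ^ 2) * |t| := by
    intro t
    have hη : 0 < 1 / (2 + |t|) := by positivity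
    filter_upwards [hκ.eventually_le_const hη, eventually_gt_atTop 0, hlb] with n hk hn hl
    have hn0 : (0 : ℝ) < n := by exact_mod_cast hn
    have hr0 : (0 : ℝ) < r n := by exact_mod_cast (by have := hr n; omega : 0 < r n)
    have hspos : 0 < s n := Real.sqrt_pos.2 (lt_of_lt_of_le (by positivity) hl)
    have hy0 : 0 ≤ y n := Real.sqrt_nonneg _
    have hsy : 1 ≤ s n * y n ^ 2 := by
      have h1 : 1 ≤ (s n * y n ^ 2) ^ 2 := by
        rw [mul_pow, ← pow_mul, hs2, hy4]
        calc (1 : ℝ) = n / r n ^ 2 * (r n ^ 2 / n) := by field_simp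
          _ ≤ _ := by gcongr
      exact (one_le_sq_iff₀ (by positivity)).1 h1
    have hk2 : s n * y n ^ 3 ≤ 1 / 2 := hk.trans
      (one_div_le_one_div_of_le two_pos (by linarith [abs_nonneg t]))
    have hts : |t| ≤ s n := by
      rw [le_div_iff₀ (by positivity)] at hk
      have hyk : y n ≤ s n * y n ^ 3 := by
        have := mul_le_mul_of_nonneg_right hsy hy0
        linarith
      have hy1 : y n ≤ 1 := by linarith
      have h1 : s n * y n ^ 3 * |t| ≤ 1 := by
        have : 0 ≤ s n * y n ^ 3 := by positivity
        nlinarith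
      have h2 : y n ^ 2 * |t| ≤ 1 := by
        have : y n ^ 2 ≤ y n := by nlinarith
        nlinarith [abs_nonneg t, mul_le_mul_of_nonneg_right (this.trans hyk) (abs_nonneg t)]
      nlinarith [mul_le_mul_of_nonneg_left h2 hspos.le,
        mul_le_mul_of_nonneg_right hsy (abs_nonneg t)]
    have h := norm_charFun_condEdgeLaw_sub_le (hr n) hn (hp0 n) hspos (hs2 n) hy0 (hy4 n) hsy hk2
      hts
    have e : s n ^ 2 - ((r n).descFactorial 2 : ℝ) ^ 2 / (2 * n ^ 2) * s n ^ 4 =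
        expEdges r p n - ((r n).descFactorial 2 : ℝ) ^ 2 * (expEdges r p n) ^ 2
            / (2 * (n : ℝ) ^ 2) := by
      rw [← hs2]
      ring
    rwa [e] at h
  refine tendsto_integral_of_tendsto_charFun ?_ fun t => ?_
  · filter_upwards [hmain 0] with n hn
    exact isProbabilityMeasure_condEdgeLaw n (r n) (hp0 n) hn.1 _ _
  · have hg : charFun (gaussianReal 0 1) t = ((Real.exp (-(t ^ 2 / 2)) : ℝ) : ℂ) := by
      rw [charFun_gaussianReal]
      push_cast
      congr 1
      simp
    rw [hg]
    refine tendsto_iff_norm_sub_tendsto_zero.2 (squeeze_zero' (.of_forall fun _ => norm_nonneg _)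
      ((hmain t).mono fun n hn => hn.2) ?_)
    simpa only [mul_zero, zero_mul] using ((hκ.const_mul 2).mul_const (21 + 3 * |t| + |t| ^ 2)).mul_const |t|
end

section
/- Let r = r(n) ≥ 3, m = m(n) and k = k(n) be integer-valued functions of n with m = o(r^{-3} n^{3/2}) and k = o( n^3 / (r^6 m^2) ) as n → ∞. Let K = K(n) be a linear r-graph on vertex set [n] with k edges, and let H be chosen uniformly at random from L_r(n,m). Then, as n → ∞, P[ every edge of K is an edge of H ] = ( [m]_k / N^k ) · exp[ [r]_2^2 k^2 / (4 n^2) + O( r^4 k / n^2 + min{ r^6 m^2 k / n^3 , r^5 m k / n^2 } ) ]. -/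
open Filter Finset

/-- `Hgraphs n r m`: the set of `r`-graphs on vertex set `Fin n` with exactly `m` edges. -/
def Hgraphs (n r m : ℕ) : Finset (Finset (Finset (Fin n))) :=
  Finset.univ.filter fun H => (∀ e ∈ H, e.card = r) ∧ H.card = m

/-- `Lgraphs n r m`: the set of linear `r`-graphs on `Fin n` with exactly `m` edges. -/
def Lgraphs (n r m : ℕ) : Finset (Finset (Finset (Fin n))) :=
  (Hgraphs n r m).filter IsLinear

/-- The `r`-subsets of `Fin n` meeting `e` in at least two vertices. -/
def conflict {n : ℕ} (r : ℕ) (e : Finset (Fin n)) : Finset (Finset (Fin n)) :=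
  (powersetCard r univ).filter fun f => 2 ≤ (f ∩ e).card

/-- The `r`-subsets of `Fin n` meeting some edge of `G` in at least two vertices. -/
def blocked {n : ℕ} (r : ℕ) (G : Finset (Finset (Fin n))) : Finset (Finset (Fin n)) :=
  G.biUnion (conflict r)

/-- The linear `r`-graphs with `m` edges containing `K`. -/
def extensions {n : ℕ} (r m : ℕ) (K : Finset (Finset (Fin n))) :
    Finset (Finset (Finset (Fin n))) :=
  (Lgraphs n r m).filter fun H => K ⊆ H

/-- The `r`-subsets of `Fin n` containing `T`. -/
def supersets {n : ℕ} (r : ℕ) (T : Finset (Fin n)) : Finset (Finset (Fin n)) :=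
  (powersetCard r univ).filter fun f => T ⊆ f

lemma mem_conflict {n r : ℕ} {e f : Finset (Fin n)} :
    f ∈ conflict r e ↔ f.card = r ∧ 2 ≤ (f ∩ e).card := by
  simp [conflict, mem_powersetCard]

lemma mem_blocked {n r : ℕ} {G : Finset (Finset (Fin n))} {f : Finset (Fin n)} :
    f ∈ blocked r G ↔ ∃ h ∈ G, f.card = r ∧ 2 ≤ (f ∩ h).card := by
  simp [blocked, mem_conflict]

lemma mem_extensions {n r m : ℕ} {K H : Finset (Finset (Fin n))} :
    H ∈ extensions r m K ↔
      (∀ e ∈ H, e.card = r) ∧ H.card = m ∧ IsLinear H ∧ K ⊆ H := by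
  simp [extensions, Lgraphs, Hgraphs, and_assoc]

lemma mem_supersets {n r : ℕ} {T f : Finset (Fin n)} :
    f ∈ supersets r T ↔ f.card = r ∧ T ⊆ f := by
  simp [supersets, mem_powersetCard]

lemma card_supersets_mul {n r : ℕ} (T : Finset (Fin n)) :
    (supersets r T).card * n.descFactorial T.card = n.choose r * r.descFactorial T.card := by
  by_cases h : T.card ≤ r
  · have h1 : (supersets r T).card = (n - T.card).choose (r - T.card) := by
      have := card_filter_powersetCard_subset T univ r (subset_univ _) h
      simpa [supersets] using this
    have h2 := Nat.choose_mul (n := n) h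
    rw [h1, Nat.descFactorial_eq_factorial_mul_choose, Nat.descFactorial_eq_factorial_mul_choose]
    rw [mul_left_comm, mul_comm ((n - T.card).choose _), ← h2]
    ring
  · have h1 : supersets r T = ∅ := by
      ext f
      simp only [mem_supersets, notMem_empty, iff_false, not_and]
      intro hf hT
      exact h (hf ▸ card_le_card hT)
    rw [h1, Nat.descFactorial_of_lt (not_le.1 h : r < T.card)]
    simp

lemma descFactorial_mul_pow_le {n r : ℕ} (hrn : r ≤ n) (t : ℕ) :
    r.descFactorial t * n ^ t ≤ r ^ t * n.descFactorial t := by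
  induction t with
  | zero => simp
  | succ t ih =>
    have h : (r - t) * n ≤ r * (n - t) := by
      rw [Nat.sub_mul, Nat.mul_sub]
      have := Nat.mul_le_mul_left t hrn
      rw [mul_comm r t]
      omega
    calc r.descFactorial (t + 1) * n ^ (t + 1)
        = ((r - t) * n) * (r.descFactorial t * n ^ t) := by
          rw [Nat.descFactorial_succ]; ring
      _ ≤ (r * (n - t)) * (r ^ t * n.descFactorial t) := Nat.mul_le_mul h ih
      _ = _ := by rw [Nat.descFactorial_succ]; ring

lemma card_supersets_le {n r : ℕ} (hrn : r ≤ n) (T : Finset (Fin n)) :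
    ((supersets r T).card : ℝ) ≤ n.choose r * ((r : ℝ) / n) ^ T.card := by
  have hT : T.card ≤ n := by simpa using card_le_univ T
  have hd : (0 : ℝ) < n.descFactorial T.card := by
    exact_mod_cast Nat.descFactorial_pos.2 hT
  have h1 : ((supersets r T).card : ℝ) * n.descFactorial T.card
      = n.choose r * r.descFactorial T.card := by exact_mod_cast card_supersets_mul T
  have h2 : (r.descFactorial T.card : ℝ) * n ^ T.card ≤ r ^ T.card * n.descFactorial T.card := by
    exact_mod_cast descFactorial_mul_pow_le hrn T.card
  rcases Nat.eq_zero_or_pos n with h0 | h0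
  · have : T.card = 0 := by omega
    subst h0
    rw [this] at h1 ⊢
    simpa using h1.le
  have hn : (0 : ℝ) < (n : ℝ) ^ T.card := by positivity
  rw [div_pow, ← mul_div_assoc, le_div_iff₀ hn]
  refine le_of_mul_le_mul_right ?_ hd
  calc _ = ((supersets r T).card * n.descFactorial T.card : ℝ) * n ^ T.card := by ring
    _ = n.choose r * (r.descFactorial T.card * n ^ T.card) := by rw [h1]; ring
    _ ≤ n.choose r * (r ^ T.card * n.descFactorial T.card) := by gcongr
    _ = _ := by ring

/-- Bonferroni's lower bound for the size of a union, with ordered pairs. -/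
lemma sum_card_le_card_biUnion_add {ι α : Type*} [DecidableEq ι] [DecidableEq α]
    (s : Finset ι) (A : ι → Finset α) :
    ∑ i ∈ s, (A i).card ≤ (s.biUnion A).card + ∑ x ∈ s.offDiag, (A x.1 ∩ A x.2).card := by
  induction s using Finset.induction_on with
  | empty => simp
  | insert a s ha ih =>
    have h1 : ((insert a s).biUnion A).card + (A a ∩ s.biUnion A).card
        = (A a).card + (s.biUnion A).card := by
      rw [biUnion_insert, card_union_add_card_inter]
    have h2 : (A a ∩ s.biUnion A).card ≤ ∑ i ∈ s, (A a ∩ A i).card := by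
      rw [inter_biUnion]
      exact card_biUnion_le
    have h3 : ∑ x ∈ s.offDiag, (A x.1 ∩ A x.2).card + ∑ i ∈ s, (A a ∩ A i).card
        ≤ ∑ x ∈ (insert a s).offDiag, (A x.1 ∩ A x.2).card := by
      have h4 : ∑ i ∈ s, (A a ∩ A i).card
          = ∑ x ∈ ({a} : Finset ι) ×ˢ s, (A x.1 ∩ A x.2).card := by
        rw [sum_product]; simp
      rw [h4, ← sum_union]
      · apply sum_le_sum_of_subset
        rw [offDiag_insert ha]
        exact subset_union_left
      · rw [disjoint_left]
        rintro ⟨x, y⟩ hx hy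
        simp only [mem_offDiag, mem_product, mem_singleton] at hx hy
        exact ha (hy.1 ▸ hx.1)
    rw [sum_insert ha]
    omega

/-- An upper bound for the proportion of `r`-subsets meeting a given one in two or more points. -/
noncomputable def conflictDensity (n r : ℕ) : ℝ :=
  ((r : ℝ) * (r - 1)) ^ 2 / (2 * (n * (n - 1)))

lemma card_supersets_two {n r : ℕ} (hn : 2 ≤ n) {T : Finset (Fin n)} (hT : T.card = 2) :
    (r.choose 2 : ℝ) * (supersets r T).card = n.choose r * conflictDensity n r := by
  have h1 : ((supersets r T).card : ℝ) * n.descFactorial 2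
      = n.choose r * r.descFactorial 2 := by
    rw [← hT]; exact_mod_cast card_supersets_mul T
  have hd : ∀ a : ℕ, (a.descFactorial 2 : ℝ) = a * (a - 1) := by
    intro a
    rw [Nat.cast_descFactorial_two]
  rw [hd, hd] at h1
  have hn1 : (2 : ℝ) ≤ n := by exact_mod_cast hn
  have h3 : (n : ℝ) * (n - 1) ≠ 0 := by
    apply mul_ne_zero <;> linarith
  rw [Nat.cast_choose_two, conflictDensity]
  have h4 : ((supersets r T).card : ℝ) = n.choose r * (r * (r - 1)) / (n * (n - 1)) := by
    rw [eq_div_iff h3, h1]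
  rw [h4]
  field_simp

lemma card_conflict_le {n r : ℕ} (hn : 2 ≤ n) {e : Finset (Fin n)} (he : e.card = r) :
    ((conflict r e).card : ℝ) ≤ n.choose r * conflictDensity n r := by
  have hsub : conflict r e ⊆ (powersetCard 2 e).biUnion (supersets r) := by
    intro f hf
    rw [mem_conflict] at hf
    obtain ⟨T, hT, hT2⟩ := exists_subset_card_eq hf.2
    rw [mem_biUnion]
    exact ⟨T, mem_powersetCard.2 ⟨hT.trans inter_subset_right, hT2⟩,
      mem_supersets.2 ⟨hf.1, hT.trans inter_subset_left⟩⟩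
  have h1 : (conflict r e).card ≤ ∑ T ∈ powersetCard 2 e, (supersets r T).card :=
    (card_le_card hsub).trans card_biUnion_le
  by_cases hr : 2 ≤ r
  · obtain ⟨T₀, hT₀, hT2⟩ := exists_subset_card_eq (he ▸ hr)
    have h2 : ∀ T ∈ powersetCard 2 e, ((supersets r T).card : ℝ) = (supersets r T₀).card := by
      intro T hT
      have hc : (r.choose 2 : ℝ) ≠ 0 := by
        exact_mod_cast (Nat.choose_pos hr).ne'
      apply mul_left_cancel₀ hc
      rw [card_supersets_two hn (mem_powersetCard.1 hT).2, card_supersets_two hn hT2]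
    calc ((conflict r e).card : ℝ) ≤ ∑ T ∈ powersetCard 2 e, ((supersets r T).card : ℝ) := by
          exact_mod_cast h1
      _ = (r.choose 2 : ℝ) * (supersets r T₀).card := by
          rw [sum_congr rfl h2, sum_const, card_powersetCard, he, nsmul_eq_mul]
      _ = _ := card_supersets_two hn hT2
  · have h3 : powersetCard 2 e = ∅ := powersetCard_eq_empty.2 (by omega)
    rw [h3] at h1
    have h4 : (conflict r e).card = 0 := by simpa using h1
    rw [h4, conflictDensity]
    have hn1 : (2 : ℝ) ≤ n := by exact_mod_cast hn
    have : (0 : ℝ) ≤ n * (n - 1) := by apply mul_nonneg <;> linarith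
    push_cast
    positivity

lemma le_card_conflict {n r : ℕ} (hn : 2 ≤ n) (hrn : r ≤ n) {e : Finset (Fin n)}
    (he : e.card = r) :
    (n.choose r : ℝ) * (conflictDensity n r - (r : ℝ) ^ 6 / n ^ 3) ≤ (conflict r e).card := by
  set A : Finset (Fin n) → Finset (Finset (Fin n)) := fun T =>
    (powersetCard r univ).filter fun f => f ∩ e = T with hA
  have hsub : (powersetCard 2 e).biUnion A ⊆ conflict r e := by
    intro f hf
    simp only [hA, mem_biUnion, mem_filter, mem_powersetCard, subset_univ, true_and] at hf
    obtain ⟨T, ⟨-, hT⟩, hf1, hf2⟩ := hf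
    rw [mem_conflict, hf2]
    exact ⟨hf1, hT.ge⟩
  have hdisj : Set.PairwiseDisjoint ((powersetCard 2 e : Finset (Finset (Fin n))) : Set _) A := by
    intro T _ T' _ hne
    rw [Function.onFun, disjoint_left]
    intro f hf hf'
    simp only [hA, mem_filter] at hf hf'
    exact hne (hf.2.symm.trans hf'.2)
  have h1 : ∑ T ∈ powersetCard 2 e, (A T).card ≤ (conflict r e).card := by
    rw [← card_biUnion hdisj]
    exact card_le_card hsub
  have h2 : ∀ T ∈ powersetCard 2 e, ((supersets r T).card : ℝ)
      - r * (n.choose r * ((r : ℝ) / n) ^ 3) ≤ (A T).card := by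
    intro T hT
    rw [mem_powersetCard] at hT
    have hcov : supersets r T ⊆ A T ∪ (e \ T).biUnion fun v => supersets r (insert v T) := by
      intro f hf
      rw [mem_supersets] at hf
      by_cases h : f ∩ e = T
      · apply mem_union_left
        simp [hA, hf.1, h]
      · apply mem_union_right
        have : ∃ v ∈ f ∩ e, v ∉ T := by
          by_contra! hcon
          exact h (subset_antisymm hcon (subset_inter hf.2 hT.1))
        obtain ⟨v, hv, hvT⟩ := this
        rw [mem_inter] at hv
        rw [mem_biUnion]
        refine ⟨v, mem_sdiff.2 ⟨hv.2, hvT⟩, mem_supersets.2 ⟨hf.1, ?_⟩⟩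
        exact insert_subset hv.1 hf.2
    have h3 : (supersets r T).card ≤ (A T).card
        + ∑ v ∈ e \ T, (supersets r (insert v T)).card :=
      (card_le_card hcov).trans ((card_union_le _ _).trans
        (Nat.add_le_add_left card_biUnion_le _))
    have h4 : ∑ v ∈ e \ T, ((supersets r (insert v T)).card : ℝ)
        ≤ r * (n.choose r * ((r : ℝ) / n) ^ 3) := by
      calc _ ≤ ∑ v ∈ e \ T, (n.choose r * ((r : ℝ) / n) ^ 3) := by
            apply sum_le_sum
            intro v hv
            have := card_supersets_le hrn (insert v T)
            rwa [card_insert_of_notMem (mem_sdiff.1 hv).2, hT.2] at this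
        _ = (e \ T).card * (n.choose r * ((r : ℝ) / n) ^ 3) := by
            rw [sum_const, nsmul_eq_mul]
        _ ≤ _ := by
            have : (e \ T).card ≤ r := he ▸ card_le_card sdiff_subset
            gcongr
    have h5 : ((supersets r T).card : ℝ) ≤ (A T).card
        + ∑ v ∈ e \ T, ((supersets r (insert v T)).card : ℝ) := by exact_mod_cast h3
    linarith
  by_cases hr : 2 ≤ r
  · have h3 : (n.choose r : ℝ) * conflictDensity n r
        - (r.choose 2 : ℝ) * (r * (n.choose r * ((r : ℝ) / n) ^ 3)) ≤ (conflict r e).card := by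
      calc _ = ∑ T ∈ powersetCard 2 e,
            ((n.choose r : ℝ) * conflictDensity n r / r.choose 2
              - r * (n.choose r * ((r : ℝ) / n) ^ 3)) := by
            have hc : (r.choose 2 : ℝ) ≠ 0 := by
              exact_mod_cast (Nat.choose_pos hr).ne'
            rw [sum_const, card_powersetCard, he, nsmul_eq_mul]
            field_simp
        _ ≤ ∑ T ∈ powersetCard 2 e, ((A T).card : ℝ) := by
            apply sum_le_sum
            intro T hT
            have hc : (0 : ℝ) < (r.choose 2 : ℝ) := by
              exact_mod_cast Nat.choose_pos hr
            have := h2 T hT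
            rw [← card_supersets_two hn (mem_powersetCard.1 hT).2,
              mul_div_cancel_left₀ _ hc.ne']
            exact this
        _ ≤ _ := by exact_mod_cast h1
    have h4 : (r.choose 2 : ℝ) ≤ r ^ 2 := by
      exact_mod_cast Nat.choose_le_pow r 2
    have h5 : (r.choose 2 : ℝ) * (r * (n.choose r * ((r : ℝ) / n) ^ 3))
        ≤ r ^ 2 * (r * (n.choose r * ((r : ℝ) / n) ^ 3)) := by gcongr
    have h6 : (r : ℝ) ^ 2 * (r * (n.choose r * ((r : ℝ) / n) ^ 3))
        = n.choose r * ((r : ℝ) ^ 6 / n ^ 3) := by rw [div_pow]; ring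
    linarith
  · have h0 : conflictDensity n r = 0 := by
      have : r = 0 ∨ r = 1 := by omega
      rcases this with h | h <;> simp [conflictDensity, h]
    rw [h0]
    have : (0 : ℝ) ≤ n.choose r * ((r : ℝ) ^ 6 / n ^ 3) := by positivity
    have h7 : (0 : ℝ) ≤ (conflict r e).card := by positivity
    linarith

lemma card_conflict_inter_le {n r : ℕ} (hrn : r ≤ n) {h h' : Finset (Fin n)}
    (hh : h.card = r) (hh' : h'.card = r) (hl : (h ∩ h').card ≤ 1) :
    ((conflict r h ∩ conflict r h').card : ℝ)
      ≤ n.choose r * ((r : ℝ) ^ 8 / n ^ 4 + (h ∩ h').card * ((r : ℝ) ^ 5 / n ^ 3)) := by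
  set P := (powersetCard 2 h ×ˢ powersetCard 2 h').filter fun x => Disjoint x.1 x.2 with hP
  set V := ((h ∩ h') ×ˢ (h ×ˢ h')).filter fun x => ({x.1, x.2.1, x.2.2} : Finset _).card = 3
    with hV
  have hcov : conflict r h ∩ conflict r h' ⊆
      (P.biUnion fun x => supersets r (x.1 ∪ x.2))
        ∪ V.biUnion fun x => supersets r {x.1, x.2.1, x.2.2} := by
    intro f hf
    rw [mem_inter, mem_conflict, mem_conflict] at hf
    obtain ⟨⟨hf, h1⟩, -, h2⟩ := hf
    by_cases hv : ∃ v ∈ h ∩ h', v ∈ f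
    · obtain ⟨v, hv, hvf⟩ := hv
      apply mem_union_right
      have hv' := mem_inter.1 hv
      obtain ⟨x, hx, hxv⟩ := exists_mem_ne (by omega : 1 < (f ∩ h).card) v
      obtain ⟨y, hy, hyv⟩ := exists_mem_ne (by omega : 1 < (f ∩ h').card) v
      rw [mem_inter] at hx hy
      have hxy : x ≠ y := by
        rintro rfl
        exact hxv (card_le_one.1 hl x (mem_inter.2 ⟨hx.2, hy.2⟩) v hv)
      rw [mem_biUnion]
      refine ⟨(v, x, y), ?_, mem_supersets.2 ⟨hf, ?_⟩⟩
      · rw [hV, mem_filter, mem_product, mem_product]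
        exact ⟨⟨hv, hx.2, hy.2⟩, card_eq_three.2 ⟨v, x, y, hxv.symm, hyv.symm, hxy, rfl⟩⟩
      · intro z hz
        simp only [mem_insert, mem_singleton] at hz
        rcases hz with rfl | rfl | rfl
        exacts [hvf, hx.1, hy.1]
    · apply mem_union_left
      push Not at hv
      obtain ⟨a, ha, ha2⟩ := exists_subset_card_eq h1
      obtain ⟨b, hb, hb2⟩ := exists_subset_card_eq h2
      rw [mem_biUnion]
      refine ⟨(a, b), ?_, mem_supersets.2 ⟨hf, ?_⟩⟩
      · rw [hP, mem_filter, mem_product, mem_powersetCard, mem_powersetCard]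
        refine ⟨⟨⟨ha.trans inter_subset_right, ha2⟩, hb.trans inter_subset_right, hb2⟩, ?_⟩
        rw [disjoint_left]
        intro z hza hzb
        have hz1 := mem_inter.1 (ha hza)
        have hz2 := mem_inter.1 (hb hzb)
        exact hv z (mem_inter.2 ⟨hz1.2, hz2.2⟩) hz1.1
      · exact union_subset (ha.trans inter_subset_left) (hb.trans inter_subset_left)
  have hPc : P.card ≤ r ^ 2 * r ^ 2 := by
    calc P.card ≤ (powersetCard 2 h ×ˢ powersetCard 2 h').card := card_filter_le _ _
      _ = r.choose 2 * r.choose 2 := by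
        rw [card_product, card_powersetCard, card_powersetCard, hh, hh']
      _ ≤ _ := Nat.mul_le_mul (Nat.choose_le_pow r 2) (Nat.choose_le_pow r 2)
  have hVc : V.card ≤ (h ∩ h').card * (r * r) := by
    calc V.card ≤ ((h ∩ h') ×ˢ (h ×ˢ h')).card := card_filter_le _ _
      _ = _ := by rw [card_product, card_product, hh, hh']
  have h1 : (conflict r h ∩ conflict r h').card ≤ ∑ x ∈ P, (supersets r (x.1 ∪ x.2)).card
      + ∑ x ∈ V, (supersets r {x.1, x.2.1, x.2.2}).card :=
    (card_le_card hcov).trans ((card_union_le _ _).trans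
      (Nat.add_le_add card_biUnion_le card_biUnion_le))
  have h2 : ∑ x ∈ P, ((supersets r (x.1 ∪ x.2)).card : ℝ)
      ≤ (r ^ 2 * r ^ 2) * (n.choose r * ((r : ℝ) / n) ^ 4) := by
    calc _ ≤ ∑ x ∈ P, (n.choose r * ((r : ℝ) / n) ^ 4) := by
          apply sum_le_sum
          intro x hx
          rw [hP, mem_filter, mem_product, mem_powersetCard, mem_powersetCard] at hx
          have := card_supersets_le hrn (x.1 ∪ x.2)
          rwa [card_union_of_disjoint hx.2, hx.1.1.2, hx.1.2.2] at this
      _ = P.card * (n.choose r * ((r : ℝ) / n) ^ 4) := by rw [sum_const, nsmul_eq_mul]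
      _ ≤ _ := by
          have : (P.card : ℝ) ≤ r ^ 2 * r ^ 2 := by exact_mod_cast hPc
          gcongr
  have h3 : ∑ x ∈ V, ((supersets r {x.1, x.2.1, x.2.2}).card : ℝ)
      ≤ ((h ∩ h').card * (r * r)) * (n.choose r * ((r : ℝ) / n) ^ 3) := by
    calc _ ≤ ∑ x ∈ V, (n.choose r * ((r : ℝ) / n) ^ 3) := by
          apply sum_le_sum
          intro x hx
          rw [hV, mem_filter] at hx
          have := card_supersets_le hrn {x.1, x.2.1, x.2.2}
          rwa [hx.2] at this
      _ = V.card * (n.choose r * ((r : ℝ) / n) ^ 3) := by rw [sum_const, nsmul_eq_mul]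
      _ ≤ _ := by
          have : (V.card : ℝ) ≤ (h ∩ h').card * (r * r) := by exact_mod_cast hVc
          gcongr
  calc ((conflict r h ∩ conflict r h').card : ℝ)
      ≤ ∑ x ∈ P, ((supersets r (x.1 ∪ x.2)).card : ℝ)
        + ∑ x ∈ V, ((supersets r {x.1, x.2.1, x.2.2}).card : ℝ) := by exact_mod_cast h1
    _ ≤ _ := add_le_add h2 h3
    _ = _ := by rw [div_pow, div_pow]; ring

lemma IsLinear.subset {n : ℕ} {G H : Finset (Finset (Fin n))} (hH : IsLinear H) (hGH : G ⊆ H) :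
    IsLinear G :=
  fun e he f hf hne => hH e (hGH he) f (hGH hf) hne

lemma IsLinear.degree_mul_le {n r : ℕ} {G : Finset (Finset (Fin n))} (hG : IsLinear G)
    (hGr : ∀ e ∈ G, e.card = r) (v : Fin n) :
    (G.filter fun h => v ∈ h).card * (r - 1) ≤ n := by
  have hdisj : Set.PairwiseDisjoint 
      ((G.filter fun h => v ∈ h : Finset (Finset (Fin n))) : Set (Finset (Fin n)))
      (fun h => h.erase v) := by
    intro h hh h' hh' hne
    simp only [coe_filter, Set.mem_ofPred_eq] at hh hh'
    rw [Function.onFun, disjoint_left]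
    intro x hx hx'
    rw [mem_erase] at hx hx'
    exact hx.1 (card_le_one.1 (hG h hh.1 h' hh'.1 hne) x (mem_inter.2 ⟨hx.2, hx'.2⟩)
      v (mem_inter.2 ⟨hh.2, hh'.2⟩))
  calc _ = ∑ h ∈ G.filter (fun h => v ∈ h), (h.erase v).card := by
        rw [← smul_eq_mul, ← sum_const]
        apply sum_congr rfl
        intro h hh
        rw [mem_filter] at hh
        rw [card_erase_of_mem hh.2, hGr h hh.1]
    _ = ((G.filter fun h => v ∈ h).biUnion fun h => h.erase v).card := (card_biUnion hdisj).symm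
    _ ≤ n := by simpa using card_le_univ ((G.filter fun h => v ∈ h).biUnion fun h => h.erase v)

lemma IsLinear.sum_card_inter_le {n r : ℕ} (hr : 2 ≤ r) {K : Finset (Finset (Fin n))}
    (hK : IsLinear K) (hKr : ∀ h ∈ K, h.card = r) {e : Finset (Fin n)} (he : e.card = r)
    (hle : ∀ h ∈ K, (e ∩ h).card ≤ 1) :
    ∑ h ∈ K, (e ∩ h).card ≤ min K.card (2 * n) := by
  apply le_min
  · calc _ ≤ ∑ h ∈ K, 1 := sum_le_sum hle
      _ = _ := by simp
  · have h1 : ∑ h ∈ K, (e ∩ h).card = ∑ v ∈ e, (K.filter fun h => v ∈ h).card := by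
      simp_rw [card_filter]
      rw [sum_comm]
      apply sum_congr rfl
      intro h _
      rw [← card_filter, filter_mem_eq_inter]
    have h2 : (∑ h ∈ K, (e ∩ h).card) * (r - 1) ≤ (2 * n) * (r - 1) := by
      calc _ = ∑ v ∈ e, (K.filter fun h => v ∈ h).card * (r - 1) := by rw [h1, sum_mul]
        _ ≤ ∑ v ∈ e, n := sum_le_sum fun v _ => hK.degree_mul_le hKr v
        _ = r * n := by rw [sum_const, he, smul_eq_mul]
        _ ≤ (2 * (r - 1)) * n := Nat.mul_le_mul_right n (by omega)
        _ = _ := by ring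
    exact Nat.le_of_mul_le_mul_right h2 (by omega)

lemma card_blocked_le {n r : ℕ} (hn : 2 ≤ n) {G : Finset (Finset (Fin n))}
    (hGr : ∀ e ∈ G, e.card = r) :
    ((blocked r G).card : ℝ) ≤ n.choose r * (G.card * conflictDensity n r) := by
  calc ((blocked r G).card : ℝ) ≤ ∑ h ∈ G, ((conflict r h).card : ℝ) := by
        exact_mod_cast card_biUnion_le
    _ ≤ ∑ h ∈ G, (n.choose r * conflictDensity n r) :=
        sum_le_sum fun h hh => card_conflict_le hn (hGr h hh)
    _ = _ := by rw [sum_const, nsmul_eq_mul]; ring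

lemma card_conflict_inter_blocked_le {n r : ℕ} (hr : 2 ≤ r) (hrn : r ≤ n)
    {K : Finset (Finset (Fin n))} (hK : IsLinear K) (hKr : ∀ h ∈ K, h.card = r)
    {e : Finset (Fin n)} (he : e.card = r) (hle : ∀ h ∈ K, (e ∩ h).card ≤ 1) :
    ∑ h ∈ K, ((conflict r e ∩ conflict r h).card : ℝ)
      ≤ n.choose r * (K.card * ((r : ℝ) ^ 8 / n ^ 4)
        + min (K.card : ℝ) (2 * n) * ((r : ℝ) ^ 5 / n ^ 3)) := by
  have h1 : (∑ h ∈ K, ((e ∩ h).card : ℝ)) ≤ min (K.card : ℝ) (2 * n) := by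
    exact_mod_cast hK.sum_card_inter_le hr hKr he hle
  calc _ ≤ ∑ h ∈ K, n.choose r * ((r : ℝ) ^ 8 / n ^ 4 + (e ∩ h).card * ((r : ℝ) ^ 5 / n ^ 3)) :=
        sum_le_sum fun h hh => card_conflict_inter_le hrn he (hKr h hh) (hle h hh)
    _ = n.choose r * (K.card * ((r : ℝ) ^ 8 / n ^ 4)
        + (∑ h ∈ K, ((e ∩ h).card : ℝ)) * ((r : ℝ) ^ 5 / n ^ 3)) := by
        rw [← mul_sum, sum_add_distrib, sum_const, nsmul_eq_mul, sum_mul]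
    _ ≤ _ := by gcongr

lemma le_card_blocked {n r : ℕ} (hn : 2 ≤ n) (hr : 2 ≤ r) (hrn : r ≤ n)
    {G : Finset (Finset (Fin n))} (hG : IsLinear G) (hGr : ∀ e ∈ G, e.card = r) :
    (n.choose r : ℝ) * (G.card * (conflictDensity n r - (r : ℝ) ^ 6 / n ^ 3
        - (G.card * ((r : ℝ) ^ 8 / n ^ 4)
          + min (G.card : ℝ) (2 * n) * ((r : ℝ) ^ 5 / n ^ 3)))) ≤ (blocked r G).card := by
  have h1 := sum_card_le_card_biUnion_add G (conflict r)
  have h2 : ∑ x ∈ G.offDiag, (conflict r x.1 ∩ conflict r x.2).card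
      = ∑ e ∈ G, ∑ h ∈ G.erase e, (conflict r e ∩ conflict r h).card := by
    rw [sum_sigma']
    apply sum_bij' (fun x _ => (⟨x.1, x.2⟩ : Σ _ : Finset (Fin n), Finset (Fin n)))
      (fun x _ => (x.1, x.2))
    · intro x hx
      rw [mem_offDiag] at hx
      simp [hx.1, hx.2.1, Ne.symm hx.2.2]
    · intro x hx
      simp only [mem_sigma, mem_erase] at hx
      simp [hx.1, hx.2.2, Ne.symm hx.2.1]
    · simp
    · simp
    · simp
  have h3 : ∑ e ∈ G, ∑ h ∈ G.erase e, ((conflict r e ∩ conflict r h).card : ℝ)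
      ≤ ∑ e ∈ G, n.choose r * (G.card * ((r : ℝ) ^ 8 / n ^ 4)
        + min (G.card : ℝ) (2 * n) * ((r : ℝ) ^ 5 / n ^ 3)) := by
    apply sum_le_sum
    intro e he
    have h4 := card_conflict_inter_blocked_le hr hrn (hG.subset (erase_subset e G))
      (fun h hh => hGr h (mem_of_mem_erase hh)) (hGr e he)
      (fun h hh => hG e he h (mem_of_mem_erase hh) (ne_of_mem_erase hh).symm)
    have h5 : ((G.erase e).card : ℝ) ≤ G.card := by exact_mod_cast card_le_card (erase_subset e G)
    refine h4.trans ?_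
    gcongr
  have h6 : ∑ e ∈ G, (n.choose r : ℝ) * (conflictDensity n r - (r : ℝ) ^ 6 / n ^ 3)
      ≤ ∑ e ∈ G, ((conflict r e).card : ℝ) :=
    sum_le_sum fun e he => le_card_conflict hn hrn (hGr e he)
  rw [h2] at h1
  have h7 : ∑ e ∈ G, ((conflict r e).card : ℝ) ≤ (blocked r G).card
      + ∑ e ∈ G, ∑ h ∈ G.erase e, ((conflict r e ∩ conflict r h).card : ℝ) := by
    exact_mod_cast h1
  rw [sum_const, nsmul_eq_mul] at h3 h6
  linarith

lemma mem_blocked_of_mem {n r : ℕ} (hr : 2 ≤ r) {G : Finset (Finset (Fin n))}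
    {e : Finset (Fin n)} (heG : e ∈ G) (he : e.card = r) : e ∈ blocked r G :=
  mem_blocked.2 ⟨e, heG, he, by rwa [inter_self, he]⟩

lemma isLinear_insert {n r : ℕ} {G : Finset (Finset (Fin n))} (hG : IsLinear G)
    {e : Finset (Fin n)} (he : e.card = r) (heG : e ∉ blocked r G) : IsLinear (insert e G) := by
  have h1 : ∀ h ∈ G, (e ∩ h).card ≤ 1 := by
    intro h hh
    by_contra hc
    exact heG (mem_blocked.2 ⟨h, hh, he, by omega⟩)
  intro a ha b hb hne
  rw [mem_insert] at ha hb
  rcases ha with rfl | ha <;> rcases hb with rfl | hb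
  · exact absurd rfl hne
  · exact h1 b hb
  · rw [inter_comm]
    exact h1 a ha
  · exact hG a ha b hb hne

lemma card_extensions_insert {n r : ℕ} (hr : 2 ≤ r) (M : ℕ) {K : Finset (Finset (Fin n))}
    {e : Finset (Fin n)} (he : e.card = r) (heK : e ∉ K) :
    (extensions r (M + 1) (insert e K)).card
      = ((extensions r M K).filter fun G => e ∉ blocked r G).card := by
  refine card_bij' (fun H _ => H.erase e) (fun G _ => insert e G) ?_ ?_ ?_ ?_
  · intro H hH
    rw [mem_extensions] at hH
    obtain ⟨h1, h2, h3, h4⟩ := hH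
    have heH : e ∈ H := h4 (mem_insert_self e K)
    rw [mem_filter, mem_extensions]
    refine ⟨⟨fun f hf => h1 f (mem_of_mem_erase hf), ?_, h3.subset (erase_subset e H), ?_⟩, ?_⟩
    · rw [card_erase_of_mem heH, h2, Nat.add_sub_cancel]
    · intro f hf
      exact mem_erase.2 ⟨fun h => heK (h ▸ hf), h4 (mem_insert_of_mem hf)⟩
    · rw [mem_blocked]
      rintro ⟨h, hh, -, hc⟩
      have := h3 e heH h (mem_of_mem_erase hh) (ne_of_mem_erase hh).symm
      omega
  · intro G hG
    rw [mem_filter, mem_extensions] at hG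
    obtain ⟨⟨h1, h2, h3, h4⟩, h5⟩ := hG
    have heG : e ∉ G := fun h => h5 (mem_blocked_of_mem hr h he)
    rw [mem_extensions]
    refine ⟨?_, ?_, isLinear_insert h3 he h5, insert_subset_insert e h4⟩
    · intro f hf
      rcases mem_insert.1 hf with rfl | hf
      exacts [he, h1 f hf]
    · rw [card_insert_of_notMem heG, h2]
  · intro H hH
    rw [mem_extensions] at hH
    exact insert_erase (hH.2.2.2 (mem_insert_self e K))
  · intro G hG
    rw [mem_filter] at hG
    exact erase_insert fun h => hG.2 (mem_blocked_of_mem hr h he)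

lemma card_extensions_succ {n r : ℕ} (hr : 2 ≤ r) (M : ℕ) (K : Finset (Finset (Fin n))) :
    ((M : ℝ) + 1 - K.card) * (extensions r (M + 1) K).card
      = ∑ G ∈ extensions r M K, ((n.choose r : ℝ) - (blocked r G).card) := by
  set R : Finset (Finset (Fin n)) := powersetCard r univ with hR
  have h1 : ∀ e ∈ R \ K, (extensions r (M + 1) (insert e K)).card
      = ((extensions r M K).filter fun G => e ∉ blocked r G).card := by
    intro e he
    rw [Finset.mem_sdiff, hR, mem_powersetCard] at he
    exact card_extensions_insert hr M he.1.2 he.2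
  have h2 : ∑ e ∈ R \ K, (extensions r (M + 1) (insert e K)).card
      = ∑ H ∈ extensions r (M + 1) K, (H \ K).card := by
    have : ∀ e, extensions r (M + 1) (insert e K)
        = (extensions r (M + 1) K).filter fun H => e ∈ H := by
      intro e
      ext H
      simp only [mem_filter, mem_extensions, insert_subset_iff]
      tauto
    simp_rw [this, card_filter]
    rw [sum_comm]
    apply sum_congr rfl
    intro H hH
    rw [← card_filter]
    congr 1
    ext e
    rw [mem_extensions] at hH
    simp only [mem_filter, Finset.mem_sdiff, hR, mem_powersetCard, subset_univ, true_and]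
    constructor
    · exact fun h => ⟨h.2, h.1.2⟩
    · exact fun h => ⟨⟨hH.1 e h.1, h.2⟩, h.1⟩
  have h3 : ∑ e ∈ R \ K, ((extensions r M K).filter fun G => e ∉ blocked r G).card
      = ∑ G ∈ extensions r M K, (R \ blocked r G).card := by
    simp_rw [card_filter]
    rw [sum_comm]
    apply sum_congr rfl
    intro G hG
    rw [← card_filter]
    congr 1
    ext e
    rw [mem_extensions] at hG
    simp only [mem_filter, Finset.mem_sdiff, hR, mem_powersetCard, subset_univ, true_and]
    constructor
    · exact fun h => ⟨h.1.1, h.2⟩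
    · exact fun h => ⟨⟨h.1, fun hK => h.2 (mem_blocked_of_mem hr (hG.2.2.2 hK) h.1)⟩, h.2⟩
  rw [sum_congr rfl h1, h3] at h2
  have h4 : ∑ H ∈ extensions r (M + 1) K, ((H \ K).card : ℝ)
      = ((M : ℝ) + 1 - K.card) * (extensions r (M + 1) K).card := by
    rw [mul_comm, ← nsmul_eq_mul, ← sum_const]
    apply sum_congr rfl
    intro H hH
    rw [mem_extensions] at hH
    rw [cast_card_sdiff hH.2.2.2, hH.2.1]
    push_cast
    ring
  have h5 : ∑ G ∈ extensions r M K, ((R \ blocked r G).card : ℝ)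
      = ∑ G ∈ extensions r M K, ((n.choose r : ℝ) - (blocked r G).card) := by
    apply sum_congr rfl
    intro G _
    have : blocked r G ⊆ R := by
      intro f hf
      rw [mem_blocked] at hf
      obtain ⟨_, _, hf, _⟩ := hf
      simp [hR, mem_powersetCard, hf]
    rw [cast_card_sdiff this, hR, card_powersetCard, card_univ, Fintype.card_fin]
  rw [← h4, ← h5]
  exact_mod_cast h2.symm

lemma sq_mul_sub_one_le (r : ℕ) : ((r : ℝ) * (r - 1)) ^ 2 ≤ r ^ 4 := by
  rcases Nat.eq_zero_or_pos r with h | h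
  · simp [h]
  · have h1 : (1 : ℝ) ≤ r := by exact_mod_cast h
    have h2 : (0 : ℝ) ≤ r * (r - 1) := mul_nonneg (by linarith) (by linarith)
    calc ((r : ℝ) * (r - 1)) ^ 2 ≤ (r * r) ^ 2 := by
          gcongr
          linarith
      _ = _ := by ring

lemma conflictDensity_nonneg {n r : ℕ} (hn : 2 ≤ n) : 0 ≤ conflictDensity n r := by
  have hn1 : (2 : ℝ) ≤ n := by exact_mod_cast hn
  have : (0 : ℝ) ≤ n * (n - 1) := by apply mul_nonneg <;> linarith
  rw [conflictDensity]
  positivity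

lemma conflictDensity_bounds {n r : ℕ} (hn : 2 ≤ n) :
    ((r : ℝ) * (r - 1)) ^ 2 / (2 * n ^ 2) ≤ conflictDensity n r ∧
    conflictDensity n r ≤ ((r : ℝ) * (r - 1)) ^ 2 / (2 * n ^ 2) + (r : ℝ) ^ 4 / n ^ 3 := by
  have hn1 : (2 : ℝ) ≤ n := by exact_mod_cast hn
  have hn0 : (0 : ℝ) < n - 1 := by linarith
  have hn2 : (0 : ℝ) < n := by linarith
  have hq := sq_mul_sub_one_le r
  have heq : conflictDensity n r = ((r : ℝ) * (r - 1)) ^ 2 / (2 * n ^ 2)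
      + ((r : ℝ) * (r - 1)) ^ 2 / (2 * (n - 1) * n ^ 2) := by
    rw [conflictDensity]
    field_simp
    ring
  constructor
  · have : 0 ≤ ((r : ℝ) * (r - 1)) ^ 2 / (2 * (n - 1) * n ^ 2) := by positivity
    linarith
  · have : ((r : ℝ) * (r - 1)) ^ 2 / (2 * (n - 1) * n ^ 2) ≤ (r : ℝ) ^ 4 / n ^ 3 := by
      apply div_le_div₀ (by positivity) hq (by positivity)
      nlinarith [sq_nonneg (n : ℝ)]
    linarith

lemma conflictDensity_le {n r : ℕ} (hn : 2 ≤ n) :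
    conflictDensity n r ≤ (r : ℝ) ^ 4 / n ^ 2 := by
  have hn1 : (2 : ℝ) ≤ n := by exact_mod_cast hn
  have hn0 : (0 : ℝ) < n - 1 := by linarith
  have hn2 : (0 : ℝ) < n := by linarith
  have hq := sq_mul_sub_one_le r
  rw [conflictDensity]
  apply div_le_div₀ (by positivity) hq (by positivity)
  nlinarith

/-- The per-edge error term. -/
noncomputable def edgeError (n r m : ℕ) : ℝ :=
  min ((r : ℝ) ^ 6 * (m : ℝ) ^ 2 / (n : ℝ) ^ 3) ((r : ℝ) ^ 5 * m / (n : ℝ) ^ 2)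

/-- The range of parameters in which the per-edge estimates are valid. -/
structure IsSparse (n r m : ℕ) : Prop where
  three_le : 3 ≤ r
  pos : 1 ≤ m
  sq_le : 100 * r ^ 2 ≤ n
  pow_le : 10 ^ 6 * (r ^ 6 * m ^ 2) ≤ n ^ 3

namespace IsSparse

variable {n r m : ℕ}

lemma le_card (h : IsSparse n r m) : 900 ≤ n := by
  have h1 := h.sq_le
  have h2 := h.three_le
  nlinarith

lemma uniformity_le (h : IsSparse n r m) : r ≤ n := by
  have h1 := h.sq_le
  nlinarith

lemma choose_pos (h : IsSparse n r m) : (0 : ℝ) < n.choose r := by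
  exact_mod_cast Nat.choose_pos h.uniformity_le

lemma edgeError_nonneg : 0 ≤ edgeError n r m := by
  rw [edgeError]; positivity

lemma mul_pow_six_le (h : IsSparse n r m) :
    (m : ℝ) * ((r : ℝ) ^ 6 / n ^ 3) ≤ edgeError n r m := by
  have hm : (1 : ℝ) ≤ m := by exact_mod_cast h.pos
  have hn : (0 : ℝ) < n := by exact_mod_cast (by have := h.le_card; omega : 0 < n)
  have hrn : (r : ℝ) ≤ n := by exact_mod_cast h.uniformity_le
  apply le_min
  · rw [← mul_div_assoc]
    gcongr ?_ / _
    nlinarith [mul_le_mul_of_nonneg_left hm (by positivity : (0 : ℝ) ≤ r ^ 6 * m)]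
  · rw [← mul_div_assoc, div_le_div_iff₀ (by positivity) (by positivity)]
    have := mul_le_mul_of_nonneg_left hrn (by positivity : (0 : ℝ) ≤ m * r ^ 5 * n ^ 2)
    nlinarith

lemma sq_mul_pow_eight_le (h : IsSparse n r m) :
    (m : ℝ) ^ 2 * ((r : ℝ) ^ 8 / n ^ 4) ≤ edgeError n r m := by
  have hm : (1 : ℝ) ≤ m := by exact_mod_cast h.pos
  have hr : (3 : ℝ) ≤ r := by exact_mod_cast h.three_le
  have hn : (1 : ℝ) ≤ n := by exact_mod_cast (by have := h.le_card; omega : 1 ≤ n)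
  have h1 : 100 * (r : ℝ) ^ 2 ≤ n := by exact_mod_cast h.sq_le
  have h2 : 10 ^ 6 * ((r : ℝ) ^ 6 * m ^ 2) ≤ n ^ 3 := by exact_mod_cast h.pow_le
  have h3 : (m : ℝ) * r ^ 3 ≤ n ^ 2 := by
    apply le_of_sq_le_sq _ (by positivity)
    have h4 : (n : ℝ) ^ 3 ≤ n ^ 4 := pow_le_pow_right₀ hn (by norm_num)
    have h5 : (0 : ℝ) ≤ r ^ 6 * m ^ 2 := by positivity
    nlinarith
  apply le_min
  · rw [← mul_div_assoc, div_le_div_iff₀ (by positivity) (by positivity)]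
    have h4 : (r : ℝ) ^ 2 ≤ n := by nlinarith [sq_nonneg (r : ℝ)]
    have := mul_le_mul_of_nonneg_left h4 (by positivity : (0 : ℝ) ≤ m ^ 2 * r ^ 6 * n ^ 3)
    nlinarith
  · rw [← mul_div_assoc, div_le_div_iff₀ (by positivity) (by positivity)]
    have := mul_le_mul_of_nonneg_left h3 (by positivity : (0 : ℝ) ≤ m * r ^ 5 * n ^ 2)
    nlinarith

lemma min_mul_pow_five_le (h : IsSparse n r m) :
    (m : ℝ) * (min (m : ℝ) (2 * n) * ((r : ℝ) ^ 5 / n ^ 3)) ≤ 2 * edgeError n r m := by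
  have hn : (0 : ℝ) < n := by exact_mod_cast (by have := h.le_card; omega : 0 < n)
  have hr : (1 : ℝ) ≤ r := by exact_mod_cast (by have := h.three_le; omega : 1 ≤ r)
  rw [edgeError, mul_min_of_nonneg _ _ zero_le_two]
  apply le_min
  · calc _ ≤ (m : ℝ) * (m * ((r : ℝ) ^ 5 / n ^ 3)) := by
          gcongr
          exact min_le_left _ _
      _ = (r : ℝ) ^ 5 * m ^ 2 / n ^ 3 := by ring
      _ ≤ (r : ℝ) ^ 6 * m ^ 2 / n ^ 3 := by
          gcongr
          norm_num
      _ ≤ _ := by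
          have : 0 ≤ (r : ℝ) ^ 6 * m ^ 2 / n ^ 3 := by positivity
          linarith
  · calc _ ≤ (m : ℝ) * ((2 * n) * ((r : ℝ) ^ 5 / n ^ 3)) := by
          gcongr
          exact min_le_right _ _
      _ = _ := by field_simp

lemma mul_density_sq_le (h : IsSparse n r m) :
    ((m : ℝ) * conflictDensity n r) ^ 2 ≤ edgeError n r m := by
  have hn : 2 ≤ n := by have := h.le_card; omega
  have h0 := conflictDensity_nonneg (r := r) hn
  calc ((m : ℝ) * conflictDensity n r) ^ 2 ≤ (m * ((r : ℝ) ^ 4 / n ^ 2)) ^ 2 := by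
        gcongr
        exact conflictDensity_le hn
    _ = (m : ℝ) ^ 2 * ((r : ℝ) ^ 8 / n ^ 4) := by rw [mul_pow, div_pow]; ring
    _ ≤ _ := h.sq_mul_pow_eight_le

lemma mul_density_le (h : IsSparse n r m) :
    (m : ℝ) * conflictDensity n r ≤ 1 / 1000 := by
  have hn : (0 : ℝ) < n := by exact_mod_cast (by have := h.le_card; omega : 0 < n)
  apply le_of_sq_le_sq _ (by norm_num)
  refine h.mul_density_sq_le.trans ((min_le_left _ _).trans ?_)
  have h2 : 10 ^ 6 * ((r : ℝ) ^ 6 * m ^ 2) ≤ n ^ 3 := by exact_mod_cast h.pow_le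
  rw [div_le_iff₀ (by positivity)]
  linarith

end IsSparse

lemma extensions_eq_empty {n r m : ℕ} {K : Finset (Finset (Fin n))} (h : m < K.card) :
    extensions r m K = ∅ := by
  ext H
  simp only [mem_extensions, notMem_empty, iff_false]
  rintro ⟨-, h2, -, h4⟩
  have := card_le_card h4
  omega

lemma filter_mem_blocked_eq {n r m : ℕ} {K : Finset (Finset (Fin n))} {e : Finset (Fin n)}
    (he : e.card = r) :
    (extensions r m K).filter (fun G => e ∈ blocked r G)
      = (conflict r e).biUnion fun g => extensions r m (insert g K) := by
  ext G
  simp only [mem_filter, mem_biUnion, mem_extensions, mem_blocked, mem_conflict, insert_subset_iff]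
  constructor
  · rintro ⟨⟨h1, h2, h3, h4⟩, g, hg, -, hc⟩
    exact ⟨g, ⟨h1 g hg, by rwa [inter_comm]⟩, h1, h2, h3, hg, h4⟩
  · rintro ⟨g, ⟨-, hc⟩, h1, h2, h3, hg, h4⟩
    exact ⟨⟨h1, h2, h3, h4⟩, g, hg, he, by rwa [inter_comm]⟩

lemma card_extensions_insert_add {n r : ℕ} (hr : 2 ≤ r) (M : ℕ) {K : Finset (Finset (Fin n))}
    {e : Finset (Fin n)} (he : e.card = r) (heK : e ∉ K) :
    (extensions r (M + 1) (insert e K)).card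
      + ((conflict r e).biUnion fun g => extensions r M (insert g K)).card
      = (extensions r M K).card := by
  rw [card_extensions_insert hr M he heK, ← filter_mem_blocked_eq he, add_comm]
  exact card_filter_add_card_filter_not _

lemma card_blocked_le_of_mem_extensions {n r M : ℕ} (hn : 2 ≤ n)
    {K G : Finset (Finset (Fin n))} (hG : G ∈ extensions r M K) :
    ((blocked r G).card : ℝ) ≤ n.choose r * (M * conflictDensity n r) := by
  rw [mem_extensions] at hG
  have := card_blocked_le hn hG.1
  rwa [hG.2.1] at this

namespace IsSparse

variable {n r m : ℕ}

lemma le_card_extensions_succ (h : IsSparse n r m) {M : ℕ} (hM : M ≤ m)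
    (K : Finset (Finset (Fin n))) :
    (n.choose r : ℝ) * (1 - m * conflictDensity n r) * (extensions r M K).card
      ≤ ((M : ℝ) + 1 - K.card) * (extensions r (M + 1) K).card := by
  have hn : 2 ≤ n := by have := h.le_card; omega
  have hr : 2 ≤ r := by have := h.three_le; omega
  have hp := conflictDensity_nonneg (r := r) hn
  rw [card_extensions_succ hr M K, mul_comm, ← nsmul_eq_mul, ← sum_const]
  apply sum_le_sum
  intro G hG
  have h1 := card_blocked_le_of_mem_extensions hn hG
  have h2 : (n.choose r : ℝ) * (M * conflictDensity n r)
      ≤ n.choose r * (m * conflictDensity n r) := by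
    have : (M : ℝ) ≤ m := by exact_mod_cast hM
    gcongr
  linarith

lemma card_extensions_succ_le (h : IsSparse n r m) (M : ℕ) (K : Finset (Finset (Fin n))) :
    ((M : ℝ) + 1 - K.card) * (extensions r (M + 1) K).card
      ≤ n.choose r * (extensions r M K).card := by
  have hr : 2 ≤ r := by have := h.three_le; omega
  rw [card_extensions_succ hr M K, mul_comm, ← nsmul_eq_mul, ← sum_const]
  apply sum_le_sum
  intro G _
  have : (0 : ℝ) ≤ (blocked r G).card := by positivity
  linarith

lemma card_extensions_insert_le (h : IsSparse n r m) {M : ℕ} (hM : M ≤ m)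
    {K : Finset (Finset (Fin n))} {f : Finset (Fin n)} (hf : f.card = r) (hfK : f ∉ K) :
    (n.choose r : ℝ) * (extensions r M (insert f K)).card
      ≤ (M - K.card) * (extensions r M K).card * (1 + 2 * (m * conflictDensity n r)) := by
  have hn : 2 ≤ n := by have := h.le_card; omega
  have hr : 2 ≤ r := by have := h.three_le; omega
  have hp := conflictDensity_nonneg (r := r) hn
  have hN := h.choose_pos
  have hd := h.mul_density_le
  set δ := (m : ℝ) * conflictDensity n r with hδ
  have hδ0 : 0 ≤ δ := by positivity
  cases M with
  | zero =>
    rw [extensions_eq_empty (m := 0) (K := insert f K) (by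
      rw [card_insert_of_notMem hfK]; omega)]
    rcases Nat.eq_zero_or_pos K.card with h0 | h0
    · simp [h0]
    · rw [extensions_eq_empty h0]
      simp
  | succ M =>
    have h1 := h.le_card_extensions_succ (by omega : M ≤ m) K
    have h2 : ((extensions r (M + 1) (insert f K)).card : ℝ) ≤ (extensions r M K).card := by
      have := card_extensions_insert_add hr M hf hfK
      exact_mod_cast (by omega)
    rw [← hδ] at h1
    push_cast
    calc (n.choose r : ℝ) * (extensions r (M + 1) (insert f K)).card
        ≤ n.choose r * (extensions r M K).card := by gcongr
      _ = (n.choose r * (extensions r M K).card) * 1 := by ring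
      _ ≤ (n.choose r * (extensions r M K).card) * ((1 - δ) * (1 + 2 * δ)) := by
        gcongr
        nlinarith
      _ = (n.choose r * (1 - δ) * (extensions r M K).card) * (1 + 2 * δ) := by ring
      _ ≤ _ := by gcongr

lemma le_card_extensions_insert (h : IsSparse n r m) {M : ℕ} (hM : M ≤ m)
    {K : Finset (Finset (Fin n))} {f : Finset (Fin n)} (hf : f.card = r)
    (hfK : f ∉ blocked r K) :
    ((M : ℝ) - K.card) * (extensions r M K).card * (1 - 2 * (m * conflictDensity n r))
      ≤ n.choose r * (extensions r M (insert f K)).card := by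
  have hn : 2 ≤ n := by have := h.le_card; omega
  have hr : 2 ≤ r := by have := h.three_le; omega
  have hp := conflictDensity_nonneg (r := r) hn
  have hN := h.choose_pos
  have hd := h.mul_density_le
  set p := conflictDensity n r with hp'
  have hδ0 : 0 ≤ (m : ℝ) * p := by positivity
  have hfK' : f ∉ K := fun hmem => hfK (mem_blocked_of_mem hr hmem hf)
  cases M with
  | zero =>
    rcases Nat.eq_zero_or_pos K.card with h0 | h0
    · simp [h0]
      positivity
    · rw [extensions_eq_empty h0]
      simp
      positivity
  | succ M =>
    set s : ℝ := ((extensions r M K).card : ℝ) with hs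
    have hs0 : 0 ≤ s := by positivity
    have h1 := h.card_extensions_succ_le M K
    have h2 : ((extensions r (M + 1) (insert f K)).card : ℝ)
        + ((conflict r f).biUnion fun g => extensions r M (insert g K)).card = s := by
      rw [hs]
      exact_mod_cast card_extensions_insert_add hr M hf hfK'
    have h3 : (((conflict r f).biUnion fun g => extensions r M (insert g K)).card : ℝ)
        ≤ ∑ g ∈ conflict r f, ((extensions r M (insert g K)).card : ℝ) := by
      exact_mod_cast card_biUnion_le
    have h4 : ∀ g ∈ conflict r f, (n.choose r : ℝ) * (extensions r M (insert g K)).card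
        ≤ m * s * (1 + 2 * (m * p)) := by
      intro g hg
      rw [mem_conflict] at hg
      have hgK : g ∉ K := fun hmem => hfK (mem_blocked.2 
        ⟨g, hmem, hf, by rw [inter_comm]; exact hg.2⟩)
      refine (h.card_extensions_insert_le (by omega) hg.1 hgK).trans ?_
      have h5 : (M : ℝ) - K.card ≤ m := by
        have h6 : (M : ℝ) ≤ m := by exact_mod_cast (by omega : M ≤ m)
        have h7 : (0 : ℝ) ≤ K.card := by positivity
        linarith
      gcongr
    have h5 : (n.choose r : ℝ) * ∑ g ∈ conflict r f, ((extensions r M (insert g K)).card : ℝ)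
        ≤ (n.choose r * p) * (m * s * (1 + 2 * (m * p))) := by
      rw [mul_sum]
      refine (sum_le_sum h4).trans ?_
      rw [sum_const, nsmul_eq_mul]
      gcongr
      exact card_conflict_le hn hf
    have h6 : (n.choose r * p) * (m * s * (1 + 2 * (m * p)))
        ≤ n.choose r * s * (2 * (m * p)) := by
      have : (m * p) * (1 + 2 * (m * p)) ≤ 2 * (m * p) := by nlinarith
      calc _ = n.choose r * s * ((m * p) * (1 + 2 * (m * p))) := by ring
        _ ≤ _ := by gcongr
    have h7 := mul_le_mul_of_nonneg_left h3 hN.le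
    have h8 : ((M : ℝ) + 1 - K.card) * (extensions r (M + 1) K).card * (1 - 2 * (m * p))
        ≤ n.choose r * s * (1 - 2 * (m * p)) :=
      mul_le_mul_of_nonneg_right h1 (by linarith)
    push_cast
    have h9 : (n.choose r : ℝ) * (extensions r (M + 1) (insert f K)).card + n.choose r
        * ((conflict r f).biUnion fun g => extensions r M (insert g K)).card = n.choose r * s := by
      rw [← mul_add, h2]
    linarith

end IsSparse

namespace IsSparse

variable {n r m : ℕ}

lemma sum_card_blocked_bounds (h : IsSparse n r m) {M : ℕ} (hM : M ≤ m)
    (K : Finset (Finset (Fin n))) :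
    (∑ G ∈ extensions r M K, ((blocked r G).card : ℝ)
      ≤ n.choose r * (M * conflictDensity n r) * (extensions r M K).card) ∧
    n.choose r * (M * conflictDensity n r - 4 * edgeError n r m) * (extensions r M K).card
      ≤ ∑ G ∈ extensions r M K, ((blocked r G).card : ℝ) := by
  have hn : 2 ≤ n := by have := h.le_card; omega
  have hr : 2 ≤ r := by have := h.three_le; omega
  have hN := h.choose_pos
  constructor
  · rw [mul_comm, ← nsmul_eq_mul, ← sum_const]
    exact sum_le_sum fun G hG => card_blocked_le_of_mem_extensions hn hG
  · rw [mul_comm, ← nsmul_eq_mul, ← sum_const]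
    apply sum_le_sum
    intro G hG
    rw [mem_extensions] at hG
    have h1 := le_card_blocked hn hr h.uniformity_le hG.2.2.1 hG.1
    rw [hG.2.1] at h1
    refine le_trans ?_ h1
    have hMm : (M : ℝ) ≤ m := by exact_mod_cast hM
    have e1 : (M : ℝ) * ((r : ℝ) ^ 6 / n ^ 3) ≤ m * ((r : ℝ) ^ 6 / n ^ 3) := by gcongr
    have e2 : (M : ℝ) * (M * ((r : ℝ) ^ 8 / n ^ 4)) ≤ m ^ 2 * ((r : ℝ) ^ 8 / n ^ 4) := by
      rw [← mul_assoc, sq]; gcongr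
    have e3 : (M : ℝ) * (min (M : ℝ) (2 * n) * ((r : ℝ) ^ 5 / n ^ 3))
        ≤ m * (min (m : ℝ) (2 * n) * ((r : ℝ) ^ 5 / n ^ 3)) := by gcongr
    have f1 := h.mul_pow_six_le
    have f2 := h.sq_mul_pow_eight_le
    have f3 := h.min_mul_pow_five_le
    gcongr
    linarith

lemma card_extensions_inter_le (h : IsSparse n r m) {M : ℕ} (hM : M ≤ m)
    {K : Finset (Finset (Fin n))} {x y : Finset (Fin n)} (hx : x.card = r) (hy : y.card = r)
    (hxy : x ≠ y) (hxK : x ∉ K) (hyK : y ∉ K) :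
    (n.choose r : ℝ) * n.choose r
        * (extensions r M (insert x K) ∩ extensions r M (insert y K)).card
      ≤ m * m * (extensions r M K).card * 2 := by
  have hn : 2 ≤ n := by have := h.le_card; omega
  have hp := conflictDensity_nonneg (r := r) hn
  have hN := h.choose_pos
  have hd := h.mul_density_le
  have hMm : (M : ℝ) ≤ m := by exact_mod_cast hM
  have hk0 : (0 : ℝ) ≤ K.card := by positivity
  have heq : extensions r M (insert x K) ∩ extensions r M (insert y K)
      = extensions r M (insert y (insert x K)) := by
    ext H
    simp only [mem_inter, mem_extensions, insert_subset_iff]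
    tauto
  have hyx : y ∉ insert x K := by
    rw [mem_insert, not_or]
    exact ⟨Ne.symm hxy, hyK⟩
  have g1 := h.card_extensions_insert_le hM hy hyx
  have g2 := h.card_extensions_insert_le hM hx hxK
  rw [card_insert_of_notMem hxK] at g1
  push_cast at g1
  rw [heq]
  have hδ0 : 0 ≤ (m : ℝ) * conflictDensity n r := by positivity
  set δ := (m : ℝ) * conflictDensity n r
  set u : ℝ := ((extensions r M (insert y (insert x K))).card : ℝ)
  set t : ℝ := ((extensions r M (insert x K)).card : ℝ) with ht
  set s : ℝ := ((extensions r M K).card : ℝ) with hs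
  set k : ℝ := (K.card : ℝ)
  set N : ℝ := (n.choose r : ℝ)
  have ht0 : 0 ≤ t := by positivity
  have hs0 : 0 ≤ s := by positivity
  have hm1 : (M - (k + 1)) * t * (1 + 2 * δ) ≤ m * t * (1 + 2 * δ) := by
    gcongr
    linarith
  have hm2 : (M - k) * s * (1 + 2 * δ) ≤ m * s * (1 + 2 * δ) := by
    gcongr
    linarith
  calc N * N * u = N * (N * u) := by ring
    _ ≤ N * (m * t * (1 + 2 * δ)) := mul_le_mul_of_nonneg_left (g1.trans hm1) hN.le
    _ = (N * t) * (m * (1 + 2 * δ)) := by ring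
    _ ≤ (m * s * (1 + 2 * δ)) * (m * (1 + 2 * δ)) :=
      mul_le_mul_of_nonneg_right (g2.trans hm2) (by positivity)
    _ = m * m * s * ((1 + 2 * δ) * (1 + 2 * δ)) := by ring
    _ ≤ _ := by
      gcongr
      nlinarith

lemma card_biUnion_conflict_le (h : IsSparse n r m) {M : ℕ} (hM : M ≤ m)
    {K : Finset (Finset (Fin n))} (hKM : K.card ≤ M) {e : Finset (Fin n)} (he : e.card = r)
    (heK : e ∉ blocked r K) :
    (((conflict r e).biUnion fun g => extensions r M (insert g K)).card : ℝ)
      ≤ ((M - K.card) * conflictDensity n r + 2 * edgeError n r m) * (extensions r M K).card := by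
  have hn : 2 ≤ n := by have := h.le_card; omega
  have hp := conflictDensity_nonneg (r := r) hn
  have hN := h.choose_pos
  have hF := h.mul_density_sq_le
  have hMm : (M : ℝ) ≤ m := by exact_mod_cast hM
  have hKM' : (K.card : ℝ) ≤ M := by exact_mod_cast hKM
  have hk0 : (0 : ℝ) ≤ K.card := by positivity
  have hnotMem : ∀ g ∈ conflict r e, g ∉ K := by
    intro g hg hgK
    rw [mem_conflict, inter_comm] at hg
    exact heK (mem_blocked.2 ⟨g, hgK, he, hg.2⟩)
  have hq := card_conflict_le hn he
  have h1 : (((conflict r e).biUnion fun g => extensions r M (insert g K)).card : ℝ)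
      ≤ ∑ g ∈ conflict r e, ((extensions r M (insert g K)).card : ℝ) := by
    exact_mod_cast card_biUnion_le
  set N : ℝ := (n.choose r : ℝ) with hNdef
  set p := conflictDensity n r with hpdef
  set F := edgeError n r m with hFdef
  set s : ℝ := ((extensions r M K).card : ℝ) with hs
  set k : ℝ := (K.card : ℝ) with hkdef
  have hs0 : 0 ≤ s := by positivity
  have ha0 : 0 ≤ (M : ℝ) - k := by linarith
  have h2 : N * ∑ g ∈ conflict r e, ((extensions r M (insert g K)).card : ℝ)
      ≤ (N * p) * ((M - k) * s * (1 + 2 * (m * p))) := by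
    rw [mul_sum]
    refine (sum_le_sum fun g hg => h.card_extensions_insert_le hM (mem_conflict.1 hg).1
      (hnotMem g hg)).trans ?_
    rw [sum_const, nsmul_eq_mul]
    gcongr
  have h3 : (M - k) * p * (2 * (m * p)) ≤ 2 * F := by
    calc (M - k) * p * (2 * (m * p)) ≤ m * p * (2 * (m * p)) := by
          gcongr
          linarith
      _ = 2 * (m * p) ^ 2 := by ring
      _ ≤ _ := by linarith
  refine h1.trans (le_of_mul_le_mul_left (h2.trans ?_) hN)
  calc _ = N * (((M - k) * p + (M - k) * p * (2 * (m * p))) * s) := by ring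
    _ ≤ _ := by gcongr

lemma le_card_conflict_sdiff_blocked (h : IsSparse n r m) {M : ℕ} (hM : M ≤ m)
    {K : Finset (Finset (Fin n))} (hKM : K.card ≤ M) (hK : IsLinear K)
    (hKr : ∀ h ∈ K, h.card = r) {e : Finset (Fin n)} (he : e.card = r) (heK : e ∉ blocked r K) :
    (n.choose r : ℝ) * ((M - K.card) * conflictDensity n r - 4 * edgeError n r m)
      ≤ (M - K.card) * (conflict r e \ blocked r K).card := by
  have hn : 2 ≤ n := by have := h.le_card; omega
  have hr : 2 ≤ r := by have := h.three_le; omega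
  have hN := h.choose_pos
  have f1 := h.mul_pow_six_le
  have f2 := h.sq_mul_pow_eight_le
  have f3 := h.min_mul_pow_five_le
  have hMm : (M : ℝ) ≤ m := by exact_mod_cast hM
  have hKM' : (K.card : ℝ) ≤ M := by exact_mod_cast hKM
  have hkm : (K.card : ℝ) ≤ m := hKM'.trans hMm
  have hk0 : (0 : ℝ) ≤ K.card := by positivity
  have hle1 : ∀ f ∈ K, (e ∩ f).card ≤ 1 := by
    intro f hf
    by_contra hc
    exact heK (mem_blocked.2 ⟨f, hf, he, by omega⟩)
  have g1 := le_card_conflict hn h.uniformity_le he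
  have g2 := card_conflict_inter_blocked_le hr h.uniformity_le hK hKr he hle1
  have g3 : ((conflict r e ∩ blocked r K).card : ℝ)
      ≤ ∑ f ∈ K, ((conflict r e ∩ conflict r f).card : ℝ) := by
    rw [blocked, inter_biUnion]
    exact_mod_cast card_biUnion_le
  have g4 : ((conflict r e \ blocked r K).card : ℝ) + (conflict r e ∩ blocked r K).card
      = (conflict r e).card := by exact_mod_cast card_sdiff_add_card_inter _ _
  have e2 : m * (K.card * ((r : ℝ) ^ 8 / n ^ 4)) ≤ m ^ 2 * ((r : ℝ) ^ 8 / n ^ 4) := by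
    rw [← mul_assoc, sq]; gcongr
  have e3 : m * (min (K.card : ℝ) (2 * n) * ((r : ℝ) ^ 5 / n ^ 3))
      ≤ m * (min (m : ℝ) (2 * n) * ((r : ℝ) ^ 5 / n ^ 3)) := by gcongr
  set b : ℝ := (r : ℝ) ^ 6 / n ^ 3 + (K.card * ((r : ℝ) ^ 8 / n ^ 4)
      + min (K.card : ℝ) (2 * n) * ((r : ℝ) ^ 5 / n ^ 3)) with hb
  have hb0 : 0 ≤ b := by positivity
  have h6 : (n.choose r : ℝ) * (conflictDensity n r - b) ≤ (conflict r e \ blocked r K).card := by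
    rw [hb]
    linarith
  have h7 : (M - K.card) * b ≤ 4 * edgeError n r m := by
    calc (M - K.card) * b ≤ m * b := by
          gcongr
          linarith
      _ ≤ _ := by rw [hb]; linarith
  have ha0 : 0 ≤ (M : ℝ) - K.card := by linarith
  calc _ ≤ (n.choose r : ℝ) * ((M - K.card) * conflictDensity n r - (M - K.card) * b) := by gcongr
    _ = (M - K.card) * (n.choose r * (conflictDensity n r - b)) := by ring
    _ ≤ _ := by gcongr

lemma le_card_biUnion_conflict (h : IsSparse n r m) {M : ℕ} (hM : M ≤ m)
    {K : Finset (Finset (Fin n))} (hKM : K.card ≤ M) (hK : IsLinear K)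
    (hKr : ∀ h ∈ K, h.card = r) {e : Finset (Fin n)} (he : e.card = r) (heK : e ∉ blocked r K) :
    ((M - K.card) * conflictDensity n r - 12 * edgeError n r m) * (extensions r M K).card
      ≤ (((conflict r e).biUnion fun g => extensions r M (insert g K)).card : ℝ) := by
  have hn : 2 ≤ n := by have := h.le_card; omega
  have hp := conflictDensity_nonneg (r := r) hn
  have hN := h.choose_pos
  have hd := h.mul_density_le
  have hF := h.mul_density_sq_le
  have hF0 : 0 ≤ edgeError n r m := edgeError_nonneg
  have hMm : (M : ℝ) ≤ m := by exact_mod_cast hM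
  have hKM' : (K.card : ℝ) ≤ M := by exact_mod_cast hKM
  have hk0 : (0 : ℝ) ≤ K.card := by positivity
  have hnotMem : ∀ g ∈ conflict r e, g ∉ K := by
    intro g hg hgK
    rw [mem_conflict, inter_comm] at hg
    exact heK (mem_blocked.2 ⟨g, hgK, he, hg.2⟩)
  have hq := card_conflict_le hn he
  have h1 : ∑ g ∈ conflict r e, ((extensions r M (insert g K)).card : ℝ)
      ≤ (((conflict r e).biUnion fun g => extensions r M (insert g K)).card : ℝ)
        + ∑ x ∈ (conflict r e).offDiag,
          ((extensions r M (insert x.1 K) ∩ extensions r M (insert x.2 K)).card : ℝ) := by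
    exact_mod_cast sum_card_le_card_biUnion_add (conflict r e)
      fun g => extensions r M (insert g K)
  have h5 : ((conflict r e \ blocked r K).card : ℝ)
      * ((M - K.card) * (extensions r M K).card * (1 - 2 * (m * conflictDensity n r)))
      ≤ n.choose r * ∑ g ∈ conflict r e, ((extensions r M (insert g K)).card : ℝ) := by
    rw [← nsmul_eq_mul, ← sum_const, mul_sum]
    refine (sum_le_sum fun g hg => ?_).trans
      (sum_le_sum_of_subset_of_nonneg sdiff_subset fun _ _ _ => by positivity)
    rw [Finset.mem_sdiff] at hg
    exact h.le_card_extensions_insert hM (mem_conflict.1 hg.1).1 hg.2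
  have h6 := h.le_card_conflict_sdiff_blocked hM hKM hK hKr he heK
  have h2 : ∀ x ∈ (conflict r e).offDiag, (n.choose r : ℝ) * n.choose r
      * ((extensions r M (insert x.1 K) ∩ extensions r M (insert x.2 K)).card : ℝ)
        ≤ m * m * (extensions r M K).card * 2 := by
    intro x hx
    rw [mem_offDiag] at hx
    exact h.card_extensions_inter_le hM (mem_conflict.1 hx.1).1 (mem_conflict.1 hx.2.1).1 hx.2.2
      (hnotMem _ hx.1) (hnotMem _ hx.2.1)
  set N : ℝ := (n.choose r : ℝ) with hNdef
  set p := conflictDensity n r with hpdef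
  set F := edgeError n r m with hFdef
  set s : ℝ := ((extensions r M K).card : ℝ) with hs
  set k : ℝ := (K.card : ℝ) with hkdef
  have hs0 : 0 ≤ s := by positivity
  have hδ0 : 0 ≤ (m : ℝ) * p := by positivity
  have h3 : N * N * ∑ x ∈ (conflict r e).offDiag,
      ((extensions r M (insert x.1 K) ∩ extensions r M (insert x.2 K)).card : ℝ)
        ≤ N * N * (2 * F * s) := by
    rw [mul_sum]
    refine (sum_le_sum h2).trans ?_
    rw [sum_const, nsmul_eq_mul]
    have g1 : ((conflict r e).offDiag.card : ℝ) ≤ (N * p) * (N * p) := by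
      calc ((conflict r e).offDiag.card : ℝ)
          ≤ ((conflict r e).card * (conflict r e).card : ℝ) := by
            rw [offDiag_card]
            exact_mod_cast Nat.sub_le _ _
        _ ≤ _ := by gcongr
    calc _ ≤ (N * p) * (N * p) * (m * m * s * 2) := by gcongr
      _ = N * N * (2 * (m * p) ^ 2 * s) := by ring
      _ ≤ _ := by gcongr
  have h4 := le_of_mul_le_mul_left h3 (mul_pos hN hN)
  have h8 : N * (((M - k) * p - 6 * F) * s)
      ≤ N * ∑ g ∈ conflict r e, ((extensions r M (insert g K)).card : ℝ) := by
    refine le_trans ?_ h5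
    have g0 : 0 ≤ s * (1 - 2 * (m * p)) := mul_nonneg hs0 (by linarith)
    have i1 : (M - k) * p * (m * p) ≤ F := by
      calc (M - k) * p * (m * p) ≤ m * p * (m * p) := by
            gcongr
            linarith
        _ = (m * p) ^ 2 := by ring
        _ ≤ _ := hF
    have i2 : 0 ≤ F * (m * p) := by positivity
    have g1 : (M - k) * p - 6 * F ≤ ((M - k) * p - 4 * F) * (1 - 2 * (m * p)) := by linarith
    calc _ ≤ N * ((((M - k) * p - 4 * F) * (1 - 2 * (m * p))) * s) := by gcongr
      _ = N * ((M - k) * p - 4 * F) * (s * (1 - 2 * (m * p))) := by ring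
      _ ≤ _ := mul_le_mul_of_nonneg_right h6 g0
      _ = _ := by ring
  have h9 := le_of_mul_le_mul_left h8 hN
  have h10 : 0 ≤ F * s := by positivity
  linarith

end IsSparse

lemma neg_sub_sq_le_log_one_sub {x : ℝ} (h1 : x ≤ 1 / 2) :
    -x - 2 * x ^ 2 ≤ Real.log (1 - x) := by
  have h := Real.one_sub_inv_le_log_of_pos (by linarith : 0 < 1 - x)
  refine le_trans ?_ h
  have h2 : (1 - x)⁻¹ ≤ 1 + x + 2 * x ^ 2 := by
    rw [inv_le_iff_one_le_mul₀ (by linarith)]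
    nlinarith [sq_nonneg x, mul_nonneg (sq_nonneg x) (by linarith : (0 : ℝ) ≤ 1 - 2 * x)]
  linarith

lemma exists_mul_exp_eq_of_density_bounds {N s X B F M k p c δ : ℝ} (hN : 0 < N) (hs : 0 ≤ s)
    (hX : 0 ≤ X) (hB : 0 ≤ B) (hF : 0 ≤ F) (hF1 : F ≤ 1 / 1000) (hδ1 : δ ≤ 1 / 1000)
    (hδF : δ ^ 2 ≤ F) (hMδ : M * p ≤ δ) (hkp : 0 ≤ k * p)
    (hc0 : 0 ≤ k * p - k * c) (hc1 : k * p - k * c ≤ F)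
    (hX1 : X ≤ ((M - k) * p + 2 * F) * s) (hX0 : ((M - k) * p - 12 * F) * s ≤ X)
    (hB1 : B ≤ N * (M * p) * s) (hB0 : N * (M * p - 4 * F) * s ≤ B) :
    ∃ err : ℝ, |err| ≤ 15 * F ∧ N * (s - X) = (N * s - B) * Real.exp (k * c + err) := by
  rcases hs.eq_or_lt with rfl | hs
  · have e1 : X = 0 := by linarith
    have e2 : B = 0 := by linarith
    exact ⟨0, by rw [abs_zero]; linarith, by rw [e1, e2]; ring⟩
  obtain ⟨x, rfl⟩ : ∃ x, X = x * s := ⟨X / s, by field_simp⟩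
  obtain ⟨y, rfl⟩ : ∃ y, B = N * y * s := ⟨B / (N * s), by field_simp⟩
  have hx1 := le_of_mul_le_mul_right hX1 hs
  have hx0 := le_of_mul_le_mul_right hX0 hs
  have hxn : 0 ≤ x := nonneg_of_mul_nonneg_left hX hs
  have hy1 := le_of_mul_le_mul_left (le_of_mul_le_mul_right hB1 hs) hN
  have hy0 := le_of_mul_le_mul_left (le_of_mul_le_mul_right hB0 hs) hN
  have hyn : 0 ≤ y := nonneg_of_mul_nonneg_right (nonneg_of_mul_nonneg_left hB hs) hN
  have hxb : x ≤ δ + 2 * F := by linarith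
  have hyb : y ≤ δ := by linarith
  have hx2 : x ^ 2 ≤ 3 * F := by
    have : x ^ 2 ≤ (δ + 2 * F) ^ 2 := by gcongr
    nlinarith [sq_nonneg (δ - 2 * F)]
  have hy2 : y ^ 2 ≤ F := (by gcongr : y ^ 2 ≤ δ ^ 2).trans hδF
  have lx0 := neg_sub_sq_le_log_one_sub (x := x) (by linarith)
  have ly0 := neg_sub_sq_le_log_one_sub (x := y) (by linarith)
  have lx1 := Real.log_le_sub_one_of_pos (by linarith : 0 < 1 - x)
  have ly1 := Real.log_le_sub_one_of_pos (by linarith : 0 < 1 - y)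
  refine ⟨Real.log (1 - x) - Real.log (1 - y) - k * c, ?_, ?_⟩
  · rw [abs_le]
    constructor <;> linarith
  · rw [add_sub_cancel, Real.exp_sub, Real.exp_log (by linarith), Real.exp_log (by linarith)]
    have : 1 - y ≠ 0 := by linarith
    field_simp

namespace IsSparse

variable {n r m : ℕ}

lemma edgeError_le (h : IsSparse n r m) : edgeError n r m ≤ 1 / 1000 := by
  have hn : (0 : ℝ) < n := by exact_mod_cast (by have := h.le_card; omega : 0 < n)
  refine (min_le_left _ _).trans ?_
  have h2 : 10 ^ 6 * ((r : ℝ) ^ 6 * m ^ 2) ≤ n ^ 3 := by exact_mod_cast h.pow_le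
  rw [div_le_iff₀ (by positivity)]
  have : 0 ≤ (r : ℝ) ^ 6 * m ^ 2 := by positivity
  linarith

lemma mul_density_sub_le (h : IsSparse n r m) {k : ℕ} (hk : k ≤ m) :
    0 ≤ (k : ℝ) * conflictDensity n r - k * (((r : ℝ) * (r - 1)) ^ 2 / (2 * n ^ 2)) ∧
    (k : ℝ) * conflictDensity n r - k * (((r : ℝ) * (r - 1)) ^ 2 / (2 * n ^ 2))
      ≤ edgeError n r m := by
  have hn : 2 ≤ n := by have := h.le_card; omega
  obtain ⟨h1, h2⟩ := conflictDensity_bounds (r := r) hn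
  have hk0 : (0 : ℝ) ≤ k := by positivity
  rw [← mul_sub]
  constructor
  · exact mul_nonneg hk0 (by linarith)
  · refine le_trans ?_ h.mul_pow_six_le
    have hr : (1 : ℝ) ≤ r := by exact_mod_cast (by have := h.three_le; omega : 1 ≤ r)
    have h3 : (r : ℝ) ^ 4 / n ^ 3 ≤ (r : ℝ) ^ 6 / n ^ 3 := by
      gcongr ?_ / _
      exact pow_le_pow_right₀ hr (by norm_num)
    have hkm : (k : ℝ) ≤ m := by exact_mod_cast hk
    calc (k : ℝ) * _ ≤ k * ((r : ℝ) ^ 6 / n ^ 3) := by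
          gcongr
          linarith
      _ ≤ _ := by gcongr

lemma exists_card_extensions_insert_eq (h : IsSparse n r m)
    {K : Finset (Finset (Fin n))} (hKm : K.card < m) (hK : IsLinear K)
    (hKr : ∀ h ∈ K, h.card = r) {e : Finset (Fin n)} (he : e.card = r) (heK : e ∉ blocked r K) :
    ∃ err : ℝ, |err| ≤ 15 * edgeError n r m ∧
      (n.choose r : ℝ) * (extensions r m (insert e K)).card
        = (m - K.card) * (extensions r m K).card
          * Real.exp (K.card * (((r : ℝ) * (r - 1)) ^ 2 / (2 * n ^ 2)) + err) := by
  have hn : 2 ≤ n := by have := h.le_card; omega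
  have hr : 2 ≤ r := by have := h.three_le; omega
  obtain ⟨M, hM⟩ : ∃ M, m = M + 1 := ⟨m - 1, by omega⟩
  have hMm : M ≤ m := by omega
  have hKM : K.card ≤ M := by omega
  have heK' : e ∉ K := fun hmem => heK (mem_blocked_of_mem hr hmem he)
  have hN := h.choose_pos
  have hp := conflictDensity_nonneg (r := r) hn
  have hd := h.mul_density_le
  have hF := h.mul_density_sq_le
  have hF0 : 0 ≤ edgeError n r m := edgeError_nonneg
  have hF1 := h.edgeError_le
  obtain ⟨hc0, hc1⟩ := h.mul_density_sub_le hKm.le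
  obtain ⟨hB1, hB0⟩ := h.sum_card_blocked_bounds hMm K
  have hX1 := h.card_biUnion_conflict_le hMm hKM he heK
  have hX0 := h.le_card_biUnion_conflict hMm hKM hK hKr he heK
  have hS : ((extensions r m (insert e K)).card : ℝ)
      + ((conflict r e).biUnion fun g => extensions r M (insert g K)).card
      = (extensions r M K).card := by
    rw [hM]
    exact_mod_cast card_extensions_insert_add hr M he heK'
  have hT : ((m : ℝ) - K.card) * (extensions r m K).card
      = n.choose r * (extensions r M K).card
        - ∑ G ∈ extensions r M K, ((blocked r G).card : ℝ) := by
    have := card_extensions_succ hr M K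
    rw [sum_sub_distrib, sum_const, nsmul_eq_mul] at this
    rw [hM, Nat.cast_succ, this]
    ring
  have hMm' : (M : ℝ) ≤ m := by exact_mod_cast hMm
  have hB : (0 : ℝ) ≤ ∑ G ∈ extensions r M K, ((blocked r G).card : ℝ) :=
    sum_nonneg fun _ _ => Nat.cast_nonneg _
  have hMp := mul_le_mul_of_nonneg_right hMm' hp
  have hkp := mul_nonneg (Nat.cast_nonneg (α := ℝ) K.card) hp
  rw [hT, eq_sub_of_add_eq hS]
  exact exists_mul_exp_eq_of_density_bounds hN (Nat.cast_nonneg _) (Nat.cast_nonneg _)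
    hB hF0 hF1 hd hF hMp hkp hc0 hc1 hX1 hX0 hB1 hB0

lemma card_extensions_empty_pos (h : IsSparse n r m) {M : ℕ} (hM : M ≤ m) :
    0 < (extensions r M (∅ : Finset (Finset (Fin n)))).card := by
  induction M with
  | zero =>
    rw [card_pos]
    exact ⟨∅, by simp [mem_extensions, IsLinear]⟩
  | succ M ih =>
    have h1 := h.le_card_extensions_succ (by omega : M ≤ m) ∅
    have h2 : (0 : ℝ) < (extensions r M (∅ : Finset (Finset (Fin n)))).card := by
      exact_mod_cast ih (by omega)
    have h3 := h.mul_density_le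
    have h4 : 0 < (n.choose r : ℝ) * (1 - m * conflictDensity n r)
        * (extensions r M (∅ : Finset (Finset (Fin n)))).card :=
      mul_pos (mul_pos h.choose_pos (by linarith)) h2
    rw [card_empty, Nat.cast_zero, sub_zero] at h1
    have h5 := pos_of_mul_pos_right (h4.trans_le h1) (by positivity)
    exact_mod_cast h5

lemma exists_card_extensions_eq (h : IsSparse n r m) (K : Finset (Finset (Fin n)))
    (hKm : K.card ≤ m) (hK : IsLinear K) (hKr : ∀ h ∈ K, h.card = r) :
    ∃ err : ℝ, |err| ≤ K.card * (15 * edgeError n r m) ∧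
      (n.choose r : ℝ) ^ K.card * (extensions r m K).card
        = m.descFactorial K.card * (extensions r m (∅ : Finset (Finset (Fin n)))).card
          * Real.exp (((r : ℝ) * (r - 1)) ^ 2 / (2 * n ^ 2) * (K.card * (K.card - 1) / 2)
            + err) := by
  induction K using Finset.induction_on with
  | empty => exact ⟨0, by simp, by simp⟩
  | insert e K heK ih =>
    rw [card_insert_of_notMem heK] at hKm ⊢
    have hsub := subset_insert e K
    obtain ⟨err₁, h1, h2⟩ := ih (by omega) (hK.subset hsub) fun f hf => hKr f (hsub hf)
    have heb : e ∉ blocked r K := by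
      rw [mem_blocked]
      rintro ⟨f, hf, -, hc⟩
      have := hK e (mem_insert_self e K) f (hsub hf) (fun heq => heK (heq ▸ hf))
      omega
    obtain ⟨err₂, h3, h4⟩ := h.exists_card_extensions_insert_eq (by omega) (hK.subset hsub)
      (fun f hf => hKr f (hsub hf)) (hKr e (mem_insert_self e K)) heb
    refine ⟨err₁ + err₂, ?_, ?_⟩
    · push_cast
      linarith [abs_add_le err₁ err₂]
    · rw [Nat.descFactorial_succ, pow_succ, mul_assoc, h4]
      push_cast [Nat.cast_sub (by omega : K.card ≤ m)]
      calc _ = ((m : ℝ) - K.card) * ((n.choose r : ℝ) ^ K.card * (extensions r m K).card)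
            * Real.exp (K.card * (((r : ℝ) * (r - 1)) ^ 2 / (2 * n ^ 2)) + err₂) := by ring
        _ = ((m : ℝ) - K.card) * m.descFactorial K.card
            * (extensions r m (∅ : Finset (Finset (Fin n)))).card
            * (Real.exp (((r : ℝ) * (r - 1)) ^ 2 / (2 * n ^ 2) * (K.card * (K.card - 1) / 2)
              + err₁)
            * Real.exp (K.card * (((r : ℝ) * (r - 1)) ^ 2 / (2 * n ^ 2)) + err₂)) := by
          rw [h2]; ring
        _ = _ := by
          rw [← Real.exp_add]
          congr 2
          ring

end IsSparse

lemma eventually_isSparse {r m : ℕ → ℕ} (hr : ∀ n, 3 ≤ r n)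
    (hm : (fun n => (m n : ℝ)) =o[atTop]
      (fun n => (n : ℝ) ^ ((3 : ℝ) / 2) / (r n : ℝ) ^ 3)) :
    ∀ᶠ n in atTop, 1 ≤ m n → IsSparse n (r n) (m n) := by
  filter_upwards [hm.def (by norm_num : (0 : ℝ) < 1 / 1000)] with n h h1
  have hr0 : (0 : ℝ) < r n := by exact_mod_cast (by have := hr n; omega : 0 < r n)
  have hn0 : (0 : ℝ) ≤ (n : ℝ) ^ ((3 : ℝ) / 2) := by positivity
  rw [Real.norm_of_nonneg (by positivity), Real.norm_of_nonneg (by positivity),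
    ← mul_div_assoc, le_div_iff₀ (by positivity)] at h
  have h2 : (1000 * ((m n : ℝ) * r n ^ 3)) ^ 2 ≤ ((n : ℝ) ^ ((3 : ℝ) / 2)) ^ 2 := by
    gcongr
    linarith
  rw [← Real.rpow_natCast ((n : ℝ) ^ ((3 : ℝ) / 2)), ← Real.rpow_mul (by positivity)] at h2
  have h3 : (n : ℝ) ^ ((3 : ℝ) / 2 * (2 : ℕ)) = (n : ℝ) ^ 3 := by
    rw [← Real.rpow_natCast (n : ℝ) 3]
    norm_num
  rw [h3] at h2
  have h4 : 10 ^ 6 * (r n ^ 6 * m n ^ 2) ≤ n ^ 3 := by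
    have : 10 ^ 6 * ((r n : ℝ) ^ 6 * m n ^ 2) ≤ n ^ 3 := by
      refine le_trans (le_of_eq ?_) h2
      ring
    exact_mod_cast this
  refine ⟨hr n, h1, ?_, h4⟩
  apply le_of_pow_le_pow_left₀ (n := 3) (by norm_num) (Nat.zero_le _)
  refine le_trans ?_ h4
  calc (100 * r n ^ 2) ^ 3 = 10 ^ 6 * (r n ^ 6 * 1) := by ring
    _ ≤ _ := by
      gcongr
      exact Nat.one_le_pow _ _ h1

/-- **Theorem 1.5**: the probability that a uniformly random linear `r`-graph with `m` edges
contains a given linear `r`-graph `K` with `k` edges, for `m = o(r⁻³n^{3/2})` and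
`k = o(n³/(r⁶m²))`. -/
theorem statement3 (r m k : ℕ → ℕ) (hr : ∀ n, 3 ≤ r n)
    (hm : (fun n => (m n : ℝ)) =o[atTop]
      (fun n => (n : ℝ) ^ ((3 : ℝ) / 2) / (r n : ℝ) ^ 3))
    (hk : (fun n => (k n : ℝ)) =o[atTop]
      (fun n => (n : ℝ) ^ 3 / ((r n : ℝ) ^ 6 * (m n : ℝ) ^ 2)))
    (K : (n : ℕ) → Finset (Finset (Fin n)))
    (hK : ∀ n, K n ∈ Lgraphs n (r n) (k n)) :
    ∃ C > (0 : ℝ), ∃ n₀ : ℕ, ∀ n ≥ n₀, ∃ err : ℝ,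
      (((Lgraphs n (r n) (m n)).filter fun H => K n ⊆ H).card : ℝ)
          / ((Lgraphs n (r n) (m n)).card : ℝ)
        = ((m n).descFactorial (k n) : ℝ) / (n.choose (r n) : ℝ) ^ (k n)
          * Real.exp (((r n).descFactorial 2 : ℝ) ^ 2 * (k n : ℝ) ^ 2 / (4 * (n : ℝ) ^ 2)
              + err) ∧
      |err| ≤ C * ((r n : ℝ) ^ 4 * (k n : ℝ) / (n : ℝ) ^ 2
        + min ((r n : ℝ) ^ 6 * (m n : ℝ) ^ 2 * (k n : ℝ) / (n : ℝ) ^ 3)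
            ((r n : ℝ) ^ 5 * (m n : ℝ) * (k n : ℝ) / (n : ℝ) ^ 2)) := by
  refine ⟨15, by norm_num, ?_⟩
  obtain ⟨n₀, hn₀⟩ := eventually_atTop.1 (eventually_isSparse hr hm)
  refine ⟨n₀, fun n hn => ?_⟩
  have hKn := hK n
  simp only [Lgraphs, Hgraphs, mem_filter, mem_univ, true_and] at hKn
  obtain ⟨⟨hKr, hKc⟩, hKl⟩ := hKn
  change ∃ err : ℝ, ((extensions (r n) (m n) (K n)).card : ℝ) / _ = _ ∧ _
  have hall : Lgraphs n (r n) (m n) = extensions (r n) (m n) ∅ := by simp [extensions]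
  rw [hall]
  by_cases hkm : m n < k n
  · refine ⟨0, ?_, by rw [abs_zero]; positivity⟩
    rw [extensions_eq_empty (hKc ▸ hkm), Nat.descFactorial_of_lt hkm]
    simp
  rcases Nat.eq_zero_or_pos (m n) with hm0 | hm0
  · refine ⟨0, ?_, by rw [abs_zero]; positivity⟩
    have hk0 : k n = 0 := by omega
    have hK0 : K n = ∅ := card_eq_zero.1 (hKc.trans hk0)
    have hpos : ((extensions (r n) (m n) (∅ : Finset (Finset (Fin n)))).card : ℝ) ≠ 0 := by
      rw [hm0]
      have : (∅ : Finset (Finset (Fin n))) ∈ extensions (r n) 0 ∅ := by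
        simp [mem_extensions, IsLinear]
      exact_mod_cast (card_pos.2 ⟨_, this⟩).ne'
    rw [hK0, div_self hpos, hk0]
    simp
  have hS := hn₀ n hn hm0
  obtain ⟨err, h1, h2⟩ := hS.exists_card_extensions_eq (K n) (by omega) hKl hKr
  rw [hKc] at h1 h2
  have hpos : (0 : ℝ) < (extensions (r n) (m n) (∅ : Finset (Finset (Fin n)))).card := by
    exact_mod_cast hS.card_extensions_empty_pos le_rfl
  have hN := hS.choose_pos
  have hd : ((r n).descFactorial 2 : ℝ) = r n * (r n - 1) := Nat.cast_descFactorial_two ℝ (r n)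
  have hn0 : (0 : ℝ) < n := by exact_mod_cast (by have := hS.le_card; omega : 0 < n)
  set c : ℝ := ((r n : ℝ) * (r n - 1)) ^ 2 with hc
  have hc4 : c ≤ (r n : ℝ) ^ 4 := sq_mul_sub_one_le (r n)
  have hc0 : 0 ≤ c := by positivity
  refine ⟨err - c * k n / (4 * n ^ 2), ?_, ?_⟩
  · rw [hd, ← hc]
    have hexp : c * (k n : ℝ) ^ 2 / (4 * (n : ℝ) ^ 2) + (err - c * k n / (4 * n ^ 2))
        = c / (2 * (n : ℝ) ^ 2) * (k n * (k n - 1) / 2) + err := by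
      field_simp
      ring
    rw [hexp, div_eq_iff hpos.ne']
    have hNk : (n.choose (r n) : ℝ) ^ k n ≠ 0 := by positivity
    apply mul_left_cancel₀ hNk
    rw [h2]
    field_simp
  · have e1 : |c * k n / (4 * (n : ℝ) ^ 2)| ≤ 15 * ((r n : ℝ) ^ 4 * k n / (n : ℝ) ^ 2) := by
      rw [abs_of_nonneg (by positivity)]
      calc c * k n / (4 * (n : ℝ) ^ 2) ≤ (r n : ℝ) ^ 4 * k n / (1 * (n : ℝ) ^ 2) := by
            gcongr
            norm_num
        _ ≤ _ := by
          rw [one_mul]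
          have : 0 ≤ (r n : ℝ) ^ 4 * k n / (n : ℝ) ^ 2 := by positivity
          linarith
    have e2 : (k n : ℝ) * (15 * edgeError n (r n) (m n))
        = 15 * min ((r n : ℝ) ^ 6 * (m n : ℝ) ^ 2 * (k n : ℝ) / (n : ℝ) ^ 3)
            ((r n : ℝ) ^ 5 * (m n : ℝ) * (k n : ℝ) / (n : ℝ) ^ 2) := by
      rw [edgeError, mul_left_comm, mul_min_of_nonneg _ _ (Nat.cast_nonneg (k n))]
      congr 2 <;> ring
    rw [e2] at h1
    refine (abs_sub _ _).trans ?_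
    linarith
end

section
/- Fix an integer t ≥ 1. Let r = r(n) ≥ 3 be an integer-valued function with r = o(n^{1/2}) as n → ∞, let m = m(n), and let α = α(n) be an integer with 0 ≤ α ≤ rt. If H is chosen uniformly at random from H_r(n,m), then the expected number of t-element sets {e_1,…,e_t} of edges of H whose union e_1 ∪ ⋯ ∪ e_t contains at most rt − α vertices is O( t^α r^{2α} m^t n^{−α} ), where the implied constant depends only on t and the bound holds uniformly in α for all sufficiently large n. -/
open Filter Finset

theorem descFactorial_mul_pow_le_pow_mul_descFactorial {m N : ℕ} (h : m ≤ N) (s : ℕ) :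
    m.descFactorial s * N ^ s ≤ m ^ s * N.descFactorial s := by
  induction s with
  | zero => simp
  | succ s ih =>
    have hstep : (m - s) * N ≤ m * (N - s) := by
      rw [Nat.sub_mul, Nat.mul_sub, Nat.mul_comm m s]
      exact Nat.sub_le_sub_left (Nat.mul_le_mul_left s h) _
    calc m.descFactorial (s + 1) * N ^ (s + 1)
        = ((m - s) * N) * (m.descFactorial s * N ^ s) := by
          rw [Nat.descFactorial_succ]; ring
      _ ≤ (m * (N - s)) * (m ^ s * N.descFactorial s) := Nat.mul_le_mul hstep ih
      _ = m ^ (s + 1) * N.descFactorial (s + 1) := by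
          rw [Nat.descFactorial_succ]; ring

theorem choose_sub_sub_mul_pow_le {s m N : ℕ} (hs : s ≤ m) (h : m ≤ N) :
    (N - s).choose (m - s) * N ^ s ≤ N.choose m * m ^ s := by
  have hdesc := descFactorial_mul_pow_le_pow_mul_descFactorial h s
  rw [Nat.descFactorial_eq_factorial_mul_choose, Nat.descFactorial_eq_factorial_mul_choose] at hdesc
  have hch : m.choose s * N ^ s ≤ m ^ s * N.choose s := by
    refine Nat.le_of_mul_le_mul_left ?_ s.factorial_pos
    linarith
  have hmul := Nat.choose_mul (n := N) hs
  refine Nat.le_of_mul_le_mul_left ?_ (Nat.choose_pos (hs.trans h))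
  calc N.choose s * ((N - s).choose (m - s) * N ^ s)
      = N.choose m * (m.choose s * N ^ s) := by rw [← mul_assoc, ← hmul, mul_assoc]
    _ ≤ N.choose m * (m ^ s * N.choose s) := Nat.mul_le_mul_left _ hch
    _ = N.choose s * (N.choose m * m ^ s) := by ring

/-- A uniformly random `m`-subset of `E` contains a given set `S` with probability at most
`(m / #E) ^ #S`. -/
theorem card_filter_superset_mul_pow_le {β : Type*} [DecidableEq β] (E S : Finset β) (m : ℕ) :
    #{H ∈ powersetCard m E | S ⊆ H} * #E ^ #S ≤ (#E).choose m * m ^ #S := by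
  by_cases hne : {H ∈ powersetCard m E | S ⊆ H}.Nonempty
  · obtain ⟨H, hH⟩ := hne
    simp only [mem_filter, mem_powersetCard] at hH
    obtain ⟨⟨hHE, hHm⟩, hSH⟩ := hH
    have hsm : #S ≤ m := hHm ▸ card_le_card hSH
    have hmE : m ≤ #E := hHm ▸ card_le_card hHE
    refine le_trans (Nat.mul_le_mul_right _ ?_) (choose_sub_sub_mul_pow_le hsm hmE)
    rw [← card_sdiff_of_subset (hSH.trans hHE), ← card_powersetCard]
    refine card_le_card_of_injOn (fun H => H \ S) ?_ ?_
    · intro H hH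
      simp only [coe_filter, mem_powersetCard, Set.mem_ofPred_eq] at hH
      simp only [mem_coe, mem_powersetCard]
      exact ⟨sdiff_subset_sdiff hH.1.1 subset_rfl, by rw [card_sdiff_of_subset hH.2, hH.1.2]⟩
    · intro H hH K hK hHK
      simp only [coe_filter, Set.mem_ofPred_eq] at hH hK
      rw [← sdiff_union_of_subset hH.2, ← sdiff_union_of_subset hK.2]
      exact congrArg (· ∪ S) hHK
  · rw [not_nonempty_iff_eq_empty.mp hne]
    simp

/-- The `t`-sets of `r`-subsets of `Fin n` whose union has at most `r * t - α` elements. -/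
def overlappingFamilies (n r t α : ℕ) : Finset (Finset (Finset (Fin n))) :=
  {S ∈ powersetCard t (powersetCard r univ) | #(S.sup id) + α ≤ r * t}

theorem exists_insert_of_mem_overlappingFamilies {n r t α : ℕ} {S : Finset (Finset (Fin n))}
    (hS : S ∈ overlappingFamilies n r (t + 1) α) :
    ∃ p ∈ antidiagonal α, ∃ T ∈ overlappingFamilies n r t p.1,
      ∃ A ∈ powersetCard p.2 (T.sup id),
        ∃ e ∈ {e ∈ powersetCard r (univ : Finset (Fin n)) | A ⊆ e}, insert e T = S := by
  simp only [overlappingFamilies, mem_filter, mem_powersetCard] at hS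
  obtain ⟨⟨hSr, hSt⟩, hunion⟩ := hS
  obtain ⟨e, T, heT, rfl, hT⟩ := card_eq_succ.mp hSt
  have her : #e = r := (mem_powersetCard.mp (hSr (mem_insert_self e T))).2
  rw [sup_insert] at hunion
  simp only [id, sup_eq_union] at hunion
  have hcard := card_union_add_card_inter e (T.sup id)
  obtain ⟨A, hA, hAcard⟩ := exists_subset_card_eq (min_le_right α #(e ∩ T.sup id))
  have hAe : A ⊆ e := hA.trans inter_subset_left
  have hAT : A ⊆ T.sup id := hA.trans inter_subset_right
  refine ⟨(α - #A, #A), ?_, T, ?_, A, ?_, e, ?_, rfl⟩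
  · rw [HasAntidiagonal.mem_antidiagonal]
    dsimp only
    omega
  · simp only [overlappingFamilies, mem_filter, mem_powersetCard]
    refine ⟨⟨(subset_insert e T).trans hSr, hT⟩, ?_⟩
    have hle : #(T.sup id) ≤ r * t := by
      rw [← hT, mul_comm, sup_eq_biUnion]
      exact card_biUnion_le_card_mul _ _ _ fun f hf =>
        (mem_powersetCard.mp (hSr (mem_insert_of_mem hf))).2.le
    rw [mul_add, mul_one] at hunion
    omega
  · exact mem_powersetCard.mpr ⟨hAT, rfl⟩
  · exact mem_filter.mpr ⟨mem_powersetCard.mpr ⟨subset_univ _, her⟩, hAe⟩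

theorem card_overlappingFamilies_mul_pow_le (n r t α : ℕ) :
    #(overlappingFamilies n r t α) * n ^ α
      ≤ (n.choose r) ^ t * (r * t.choose 2).choose α * r ^ α := by
  induction t generalizing α with
  | zero =>
    rcases Nat.eq_zero_or_pos α with rfl | hα
    · simp only [overlappingFamilies, powersetCard_zero]
      simpa using card_filter_le ({∅} : Finset (Finset (Finset (Fin n)))) _
    · have : overlappingFamilies n r 0 α = ∅ := by
        refine filter_eq_empty_iff.mpr fun S _ => ?_
        omega
      simp [this]
  | succ t ih =>
    have hsub : overlappingFamilies n r (t + 1) α ⊆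
        (antidiagonal α).biUnion fun p => (overlappingFamilies n r t p.1).biUnion fun T =>
          (powersetCard p.2 (T.sup id)).biUnion fun A =>
            {e ∈ powersetCard r (univ : Finset (Fin n)) | A ⊆ e}.image fun e => insert e T := by
      intro S hS
      simpa only [mem_biUnion, mem_image] using exists_insert_of_mem_overlappingFamilies hS
    have hA (p : ℕ × ℕ) (T : Finset (Finset (Fin n)))
        (hT : T ∈ overlappingFamilies n r t p.1) :
        #((powersetCard p.2 (T.sup id)).biUnion fun A =>
          {e ∈ powersetCard r (univ : Finset (Fin n)) | A ⊆ e}.image fun e => insert e T)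
            * n ^ p.2 ≤ (r * t).choose p.2 * (n.choose r * r ^ p.2) := by
      refine (Nat.mul_le_mul_right _ card_biUnion_le).trans ?_
      rw [sum_mul]
      refine (sum_le_card_nsmul _ _ (n.choose r * r ^ p.2) fun A hA => ?_).trans ?_
      · refine (Nat.mul_le_mul_right _ card_image_le).trans ?_
        have := card_filter_superset_mul_pow_le (univ : Finset (Fin n)) A r
        rwa [card_univ, Fintype.card_fin, (mem_powersetCard.mp hA).2] at this
      · rw [smul_eq_mul, card_powersetCard]
        refine Nat.mul_le_mul_right _ (Nat.choose_le_choose _ ?_)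
        have := (mem_filter.mp hT).2
        omega
    calc #(overlappingFamilies n r (t + 1) α) * n ^ α
        ≤ (∑ p ∈ antidiagonal α, ∑ T ∈ overlappingFamilies n r t p.1,
            #((powersetCard p.2 (T.sup id)).biUnion fun A =>
              {e ∈ powersetCard r (univ : Finset (Fin n)) | A ⊆ e}.image
                fun e => insert e T)) * n ^ α := by
          refine Nat.mul_le_mul_right _ ((card_le_card hsub).trans (card_biUnion_le.trans ?_))
          exact sum_le_sum fun p _ => card_biUnion_le
      _ ≤ ∑ p ∈ antidiagonal α, (n.choose r ^ (t + 1) * r ^ α) *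
            ((r * t.choose 2).choose p.1 * (r * t).choose p.2) := by
          rw [sum_mul]
          refine sum_le_sum fun p hp => ?_
          rw [HasAntidiagonal.mem_antidiagonal] at hp
          rw [← hp, pow_add n, mul_left_comm, sum_mul, mul_comm]
          refine (Nat.mul_le_mul_right _ (sum_le_card_nsmul _ _ _ (hA p))).trans ?_
          rw [smul_eq_mul]
          calc _ = (#(overlappingFamilies n r t p.1) * n ^ p.1) *
                  ((r * t).choose p.2 * (n.choose r * r ^ p.2)) := by ring
            _ ≤ (n.choose r ^ t * (r * t.choose 2).choose p.1 * r ^ p.1) *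
                  ((r * t).choose p.2 * (n.choose r * r ^ p.2)) :=
                Nat.mul_le_mul_right _ (ih p.1)
            _ = _ := by ring
      _ = n.choose r ^ (t + 1) * (r * (t + 1).choose 2).choose α * r ^ α := by
          have hchoose : r * (t + 1).choose 2 = r * t.choose 2 + r * t := by
            rw [Nat.choose_succ_succ' t 1, Nat.choose_one_right]
            ring
          rw [← mul_sum, ← Nat.add_choose_eq, hchoose, mul_right_comm]

theorem Hgraphs_eq_powersetCard (n r m : ℕ) :
    Hgraphs n r m = powersetCard m (powersetCard r univ) := by
  ext H
  simp [Hgraphs, mem_powersetCard, subset_iff]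

theorem sum_card_overlapping_mul_le {n r : ℕ} (hrn : r ≤ n) (m : ℕ) {t α : ℕ}
    (hα : α ≤ r * t) :
    (∑ H ∈ Hgraphs n r m,
        #{S ∈ H.powerset | #S = t ∧ #(S.sup id) ≤ r * t - α}) * n ^ α
      ≤ (r * t.choose 2).choose α * r ^ α * m ^ t * #(Hgraphs n r m) := by
  set E : Finset (Finset (Fin n)) := powersetCard r univ with hE
  have hEcard : #E = n.choose r := by simp [hE]
  have hdouble : ∑ H ∈ Hgraphs n r m,
      #{S ∈ H.powerset | #S = t ∧ #(S.sup id) ≤ r * t - α}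
        = ∑ S ∈ overlappingFamilies n r t α, #{H ∈ powersetCard m E | S ⊆ H} := by
    rw [Hgraphs_eq_powersetCard, ← hE]
    refine Eq.trans ?_ (sum_card_bipartiteAbove_eq_sum_card_bipartiteBelow
      (fun H S : Finset (Finset (Fin n)) => S ⊆ H))
    refine sum_congr rfl fun H hH => congrArg card ?_
    ext S
    have hHE := (mem_powersetCard.mp hH).1
    simp only [bipartiteAbove, overlappingFamilies, mem_filter, mem_powerset, mem_powersetCard,
      ← hE]
    constructor
    · rintro ⟨hSH, hSt, hS⟩
      exact ⟨⟨⟨hSH.trans hHE, hSt⟩, by omega⟩, hSH⟩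
    · rintro ⟨⟨⟨-, hSt⟩, hS⟩, hSH⟩
      exact ⟨hSH, hSt, by omega⟩
  have hHcard : #(Hgraphs n r m) = (#E).choose m := by
    rw [Hgraphs_eq_powersetCard, card_powersetCard]
  have hsum : (∑ S ∈ overlappingFamilies n r t α, #{H ∈ powersetCard m E | S ⊆ H}) * #E ^ t
      ≤ #(overlappingFamilies n r t α) * ((#E).choose m * m ^ t) := by
    rw [sum_mul, ← smul_eq_mul (#(overlappingFamilies n r t α))]
    refine sum_le_card_nsmul _ _ _ fun S hS => ?_
    have hSt : #S = t := (mem_powersetCard.mp (mem_filter.mp hS).1).2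
    simpa only [hSt] using card_filter_superset_mul_pow_le E S m
  have hpos : 0 < #E ^ t := pow_pos (hEcard ▸ Nat.choose_pos hrn) t
  refine Nat.le_of_mul_le_mul_right ?_ hpos
  rw [hdouble, hHcard, mul_right_comm]
  refine (Nat.mul_le_mul_right _ hsum).trans ?_
  calc _ = (#(overlappingFamilies n r t α) * n ^ α) * ((#E).choose m * m ^ t) := by ring
    _ ≤ _ := Nat.mul_le_mul_right _ (card_overlappingFamilies_mul_pow_le n r t α)
    _ = _ := by rw [← hEcard]; ring

theorem choose_mul_choose_two_le_exp (r t α : ℕ) :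
    ((r * t.choose 2).choose α : ℝ) ≤ Real.exp t * t ^ α * r ^ α := by
  have ht : (t.choose 2 : ℝ) ≤ t ^ 2 := mod_cast Nat.choose_le_pow t 2
  calc ((r * t.choose 2).choose α : ℝ)
      ≤ ((r * t.choose 2 : ℕ) : ℝ) ^ α / α.factorial := Nat.choose_le_pow_div α _
    _ ≤ ((r : ℝ) * t ^ 2) ^ α / α.factorial := by
        push_cast
        gcongr
    _ = (t : ℝ) ^ α / α.factorial * t ^ α * r ^ α := by ring
    _ ≤ Real.exp t * t ^ α * r ^ α := by
        gcongr
        exact Real.pow_div_factorial_le_exp _ (Nat.cast_nonneg t) α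

/-- **Lemma 2.2**: for fixed `t`, `r = o(n^{1/2})` and `0 ≤ α ≤ rt`, the expected number of
`t`-sets of edges of a uniformly random `H ∈ H_r(n,m)` whose union has at most `rt - α`
vertices is `O(t^α r^{2α} m^t n^{-α})`, uniformly in `α`. -/
theorem statement5 (t : ℕ) (ht : 1 ≤ t) (r m α : ℕ → ℕ)
    (hr : ∀ n, 3 ≤ r n)
    (hro : (fun n => (r n : ℝ)) =o[atTop] (fun n => (n : ℝ) ^ ((1 : ℝ) / 2)))
    (hα : ∀ n, α n ≤ r n * t) :
    ∃ C > (0 : ℝ), ∃ n₀ : ℕ, ∀ n ≥ n₀,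
      (∑ H ∈ Hgraphs n (r n) (m n),
          ((H.powerset.filter fun S =>
              S.card = t ∧ (S.sup id).card ≤ r n * t - α n).card : ℝ))
          / ((Hgraphs n (r n) (m n)).card : ℝ)
        ≤ C * (t : ℝ) ^ (α n) * (r n : ℝ) ^ (2 * α n) * (m n : ℝ) ^ t / (n : ℝ) ^ (α n) := by
  obtain ⟨n₀, hn₀⟩ := eventually_atTop.mp (hro.bound one_pos)
  refine ⟨Real.exp t, Real.exp_pos _, max n₀ 1, fun n hn => ?_⟩
  have hn1 : (1 : ℝ) ≤ n := mod_cast (le_max_right _ _).trans hn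
  have hrn : r n ≤ n := by
    have h := hn₀ n ((le_max_left _ _).trans hn)
    rw [one_mul, Real.norm_of_nonneg (by positivity), Real.norm_of_nonneg (by positivity)] at h
    have h' : (n : ℝ) ^ ((1 : ℝ) / 2) ≤ n :=
      Real.rpow_le_self_of_one_le hn1 (by norm_num)
    exact_mod_cast h.trans h'
  have hcount : (∑ H ∈ Hgraphs n (r n) (m n),
      (#{S ∈ H.powerset | #S = t ∧ #(S.sup id) ≤ r n * t - α n} : ℝ)) * (n : ℝ) ^ α n
        ≤ ((r n * t.choose 2).choose (α n) : ℝ) * (r n : ℝ) ^ α n * (m n : ℝ) ^ t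
          * #(Hgraphs n (r n) (m n)) :=
    mod_cast sum_card_overlapping_mul_le hrn (m n) (hα n)
  refine div_le_of_le_mul₀ (by positivity) (by positivity) ?_
  rw [div_mul_eq_mul_div, le_div_iff₀ (by positivity)]
  refine hcount.trans ?_
  calc _ ≤ (Real.exp t * t ^ α n * r n ^ α n) * (r n : ℝ) ^ α n * (m n : ℝ) ^ t
          * #(Hgraphs n (r n) (m n)) := by
        gcongr
        exact choose_mul_choose_two_le_exp (r n) t (α n)
    _ = _ := by ring
end
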